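/- arXiv:1903.02216 — 2 statements merged into one kernel-verified Lean document; each statement's English description precedes it below -/
import Mathlib

section
/- Let λ = (1 − β f′(b))/n and define, for σ ∈ Ω_n, D₂(σ) = (1/n) ∑_{i=1}^n ∫_{S^{N−1}} (W_n(σ) − W_n(σ^{i,τ}))² g_{σ,i}(τ) dμ(τ). Then there exists a constant C > 0, depending only on β and N, such that for every n ≥ 1, E_{P_{n,β}} |(1/(2λ)) D₂ − B²| ≤ C n^{−1/2}, where B² = (4β²/((1 − β f′(b)) b²)) (1 − (N−1) f(b)/b − f(b)²). -/
open MeasureTheory Real RealInnerProductSpace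

noncomputable section

def besselRatio (N : ℕ) (x : ℝ) : ℝ :=
  x / ((N : ℝ) - 1) *
      (∫ θ in (0:ℝ)..π, Real.exp (x * Real.cos θ) * Real.sin θ ^ N) /
    ∫ θ in (0:ℝ)..π, Real.exp (x * Real.cos θ) * Real.sin θ ^ (N - 2)

/-- The unit sphere `S^{N-1}` in `ℝ^N`. -/
abbrev UnitSphere (N : ℕ) := Metric.sphere (0 : EuclideanSpace ℝ (Fin N)) 1

/-- The map on the unit sphere induced by a linear isometry of `ℝ^N`. -/
def sphereMap {N : ℕ}
    (e : EuclideanSpace ℝ (Fin N) ≃ₗᵢ[ℝ] EuclideanSpace ℝ (Fin N))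
    (θ : UnitSphere N) : UnitSphere N :=
  ⟨e θ, by
    rw [mem_sphere_zero_iff_norm, e.norm_map]
    exact mem_sphere_zero_iff_norm.mp θ.2⟩

/-- Total spin `S_n(σ) = ∑ i, σ_i`. -/
def totalSpin {N n : ℕ} (σ : Fin n → UnitSphere N) : EuclideanSpace ℝ (Fin N) :=
  ∑ i, (σ i : EuclideanSpace ℝ (Fin N))

/-- `W_n(σ) = √n (β²/(n²b²) |S_n(σ)|² - 1)`. -/
def Wspin (N n : ℕ) (β b : ℝ) (σ : Fin n → UnitSphere N) : ℝ :=
  Real.sqrt n * (β ^ 2 / ((n : ℝ) ^ 2 * b ^ 2) * ‖totalSpin σ‖ ^ 2 - 1)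

/-- The (unnormalized) Gibbs weight `exp((β/(2n)) ∑_i ∑_j ⟨σ_i, σ_j⟩)`. -/
def gibbsWeight (N n : ℕ) (β : ℝ) (σ : Fin n → UnitSphere N) : ℝ :=
  Real.exp (β / (2 * n) * ∑ i, ∑ j,
    ⟪(σ i : EuclideanSpace ℝ (Fin N)), (σ j : EuclideanSpace ℝ (Fin N))⟫)

/-- The Gibbs measure `P_{n,β}` on `(S^{N-1})^n`. -/
def gibbsMeasure (N n : ℕ) (β : ℝ) (μ : Measure (UnitSphere N))
    [IsProbabilityMeasure μ] : Measure (Fin n → UnitSphere N) :=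
  (Measure.pi fun _ : Fin n => μ).withDensity fun σ =>
    ENNReal.ofReal
      (gibbsWeight N n β σ / ∫ τ, gibbsWeight N n β τ ∂(Measure.pi fun _ : Fin n => μ))

end
noncomputable section

/-- The conditional density under the Gibbs measure of the `i`-th spin given the others:
`g_{σ,i}(τ) = exp((β/n)⟨τ, S_n(σ) - σ_i⟩) / Z_{σ,i}`. -/
def condDens (N n : ℕ) (β : ℝ) (μ : Measure (UnitSphere N))
    (σ : Fin n → UnitSphere N) (i : Fin n) (τ : UnitSphere N) : ℝ :=
  Real.exp (β / n *
      ⟪(τ : EuclideanSpace ℝ (Fin N)), totalSpin σ - (σ i : EuclideanSpace ℝ (Fin N))⟫) /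
    ∫ τ', Real.exp (β / n *
      ⟪(τ' : EuclideanSpace ℝ (Fin N)), totalSpin σ - (σ i : EuclideanSpace ℝ (Fin N))⟫) ∂μ

/-- `D₂(σ) = (1/n) ∑ᵢ ∫ (W_n(σ) - W_n(σ^{i,τ}))² g_{σ,i}(τ) dμ(τ)`, the conditional
second moment of `W_n - W_n'` given `σ` for the exchangeable pair obtained by resampling a
uniformly chosen coordinate. -/
def D2 (N n : ℕ) (β b : ℝ) (μ : Measure (UnitSphere N))
    (σ : Fin n → UnitSphere N) : ℝ :=
  (1 / (n : ℝ)) * ∑ i, ∫ τ,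
    (Wspin N n β b σ - Wspin N n β b (Function.update σ i τ)) ^ 2 * condDens N n β μ σ i τ ∂μ

lemma aux_hasDerivAt_integral {X : Type*} [TopologicalSpace X] [CompactSpace X]
    [MeasurableSpace X] [BorelSpace X] (μ : Measure X) [IsFiniteMeasure μ]
    (F F' : ℝ → X → ℝ) (hF : ∀ t, Continuous (F t)) (hF' : Continuous (Function.uncurry F'))
    (h : ∀ t x, HasDerivAt (fun s => F s x) (F' t x) t) (t : ℝ) :
    HasDerivAt (fun s => ∫ x, F s x ∂μ) (∫ x, F' t x ∂μ) t := by
  obtain ⟨C, hC⟩ := ((isCompact_Icc (a := t - 1) (b := t + 1)).prod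
    (isCompact_univ (X := X))).exists_bound_of_continuousOn hF'.continuousOn
  have hc : ∀ t, Continuous (F' t) := fun t => hF'.comp (Continuous.prodMk_right t)
  refine (hasDerivAt_integral_of_dominated_loc_of_deriv_le (s := Set.Icc (t - 1) (t + 1))
    (bound := fun _ => C) (Icc_mem_nhds (by linarith) (by linarith)) ?_ ?_ ?_ ?_ ?_ ?_).2
  · exact Filter.Eventually.of_forall fun s =>
      ((hF s).integrable_of_hasCompactSupport (HasCompactSupport.of_compactSpace _)).1
  · exact (hF t).integrable_of_hasCompactSupport (HasCompactSupport.of_compactSpace _)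
  · exact ((hc t).integrable_of_hasCompactSupport (HasCompactSupport.of_compactSpace _)).1
  · exact Filter.Eventually.of_forall fun x s hs => hC (s, x) ⟨hs, Set.mem_univ _⟩
  · exact integrable_const _
  · exact Filter.Eventually.of_forall fun x s hs => h s x

lemma aux_integrable {X : Type*} [TopologicalSpace X] [CompactSpace X]
    [MeasurableSpace X] [BorelSpace X] (μ : Measure X) [IsFiniteMeasure μ]
    {G : X → ℝ} (hG : Continuous G) : Integrable G μ :=
  hG.integrable_of_hasCompactSupport (HasCompactSupport.of_compactSpace _)

section sphere
variable {N : ℕ} {μ : Measure (UnitSphere N)} [IsProbabilityMeasure μ]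

lemma sphereMap_continuous (e : EuclideanSpace ℝ (Fin N) ≃ₗᵢ[ℝ] EuclideanSpace ℝ (Fin N)) :
    Continuous (sphereMap e) :=
  Continuous.subtype_mk (e.continuous.comp continuous_subtype_val) _

lemma sphere_integral_inv
    (hμinv : ∀ e : EuclideanSpace ℝ (Fin N) ≃ₗᵢ[ℝ] EuclideanSpace ℝ (Fin N),
      Measure.map (sphereMap e) μ = μ)
    (e : EuclideanSpace ℝ (Fin N) ≃ₗᵢ[ℝ] EuclideanSpace ℝ (Fin N))
    (G : EuclideanSpace ℝ (Fin N) → ℝ) (hG : Continuous G) :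
    ∫ τ : UnitSphere N, G (e τ) ∂μ = ∫ τ : UnitSphere N, G τ ∂μ := by
  conv_rhs => rw [← hμinv e]
  rw [integral_map (sphereMap_continuous e).aemeasurable
    (by exact (hG.comp continuous_subtype_val).aestronglyMeasurable)]
  rfl

lemma integral_odd
    (hμinv : ∀ e : EuclideanSpace ℝ (Fin N) ≃ₗᵢ[ℝ] EuclideanSpace ℝ (Fin N),
      Measure.map (sphereMap e) μ = μ)
    (v w : EuclideanSpace ℝ (Fin N)) (hvw : ⟪v, w⟫ = 0) (F : ℝ → ℝ) (hF : Continuous F) :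
    ∫ τ : UnitSphere N, F ⟪(τ : EuclideanSpace ℝ (Fin N)), v⟫ *
      ⟪(τ : EuclideanSpace ℝ (Fin N)), w⟫ ∂μ = 0 := by
  set R := (Submodule.span ℝ {w})ᗮ.reflection with hR
  have h1 : R v = v := Submodule.reflection_mem_subspace_eq_self
    (Submodule.mem_orthogonal_singleton_iff_inner_left.2 hvw)
  have h2 : R w = -w := Submodule.reflection_orthogonalComplement_singleton_eq_neg w
  have := sphere_integral_inv hμinv R (fun τ => F ⟪τ, v⟫ * ⟪τ, w⟫) (by fun_prop)
  have e1 : ∀ τ, ⟪R τ, v⟫ = ⟪τ, v⟫ := fun τ => by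
    conv_lhs => rw [← h1]
    exact R.inner_map_map _ _
  have e2 : ∀ τ, ⟪R τ, w⟫ = -⟪τ, w⟫ := fun τ => by
    have := R.inner_map_map τ w
    rw [h2, inner_neg_right] at this
    linarith
  simp only [e1, e2, mul_neg, integral_neg] at this
  linarith

lemma integral_unit
    (hμinv : ∀ e : EuclideanSpace ℝ (Fin N) ≃ₗᵢ[ℝ] EuclideanSpace ℝ (Fin N),
      Measure.map (sphereMap e) μ = μ)
    (v w : EuclideanSpace ℝ (Fin N)) (hvw : ‖v‖ = ‖w‖) (F : ℝ → ℝ) (hF : Continuous F) :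
    ∫ τ : UnitSphere N, F ⟪(τ : EuclideanSpace ℝ (Fin N)), v⟫ ∂μ =
    ∫ τ : UnitSphere N, F ⟪(τ : EuclideanSpace ℝ (Fin N)), w⟫ ∂μ := by
  set R := (Submodule.span ℝ {v - w})ᗮ.reflection with hR
  have h1 : R v = w := Submodule.reflection_sub hvw
  rw [← sphere_integral_inv hμinv R (fun τ => F ⟪τ, w⟫) (by fun_prop)]
  simp only [← h1, R.inner_map_map]

lemma sphere_coord_eq (τ : UnitSphere N) (i : Fin N) :
    ⟪(τ : EuclideanSpace ℝ (Fin N)), EuclideanSpace.single i (1:ℝ)⟫ = τ.1 i := by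
  simp [EuclideanSpace.inner_single_right]

lemma sphere_sum_sq (τ : UnitSphere N) : ∑ i, τ.1 i ^ 2 = 1 := by
  have : ‖τ.1‖ ^ 2 = 1 := by rw [mem_sphere_zero_iff_norm.mp τ.2]; norm_num
  rwa [EuclideanSpace.real_norm_sq_eq] at this

lemma integral_parts_two
    (hμinv : ∀ e : EuclideanSpace ℝ (Fin N) ≃ₗᵢ[ℝ] EuclideanSpace ℝ (Fin N),
      Measure.map (sphereMap e) μ = μ)
    (h h' : ℝ → ℝ) (hh : ∀ x, HasDerivAt h (h' x) x) (hc : Continuous h') (i j : Fin N)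
    (hij : i ≠ j) :
    ∫ τ : UnitSphere N, h' (τ.1 i) * τ.1 j ^ 2 ∂μ = ∫ τ : UnitSphere N, h (τ.1 i) * τ.1 i ∂μ := by
  have hcont : Continuous h := continuous_iff_continuousAt.2 fun x => (hh x).continuousAt
  have hco : ∀ k : Fin N, Continuous (fun τ : UnitSphere N => τ.1 k) := fun k => by fun_prop
  have hco' : ∀ k : Fin N, Continuous (fun τ : ℝ × UnitSphere N => τ.2.1 k) := fun k => by fun_prop
  have key := aux_hasDerivAt_integral μ
    (fun t τ => h (τ.1 i + t * τ.1 j) * (τ.1 j - t * τ.1 i))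
    (fun t τ => (h' (τ.1 i + t * τ.1 j) * τ.1 j) * (τ.1 j - t * τ.1 i)
      + h (τ.1 i + t * τ.1 j) * (-τ.1 i))
    (fun t => by fun_prop) (by simp only [Function.uncurry_def]; fun_prop)
    (fun t τ => by
      have h1 : HasDerivAt (fun s : ℝ => τ.1 i + s * τ.1 j) (τ.1 j) t := by
        simpa using ((hasDerivAt_id t).mul_const (τ.1 j)).const_add (τ.1 i)
      have h2 : HasDerivAt (fun s : ℝ => τ.1 j - s * τ.1 i) (-τ.1 i) t := by
        simpa using ((hasDerivAt_id t).mul_const (τ.1 i)).const_sub (τ.1 j)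
      exact (HasDerivAt.comp t (hh _) h1).mul h2) 0
  have hz : (fun t : ℝ => ∫ τ : UnitSphere N, h (τ.1 i + t * τ.1 j) * (τ.1 j - t * τ.1 i) ∂μ)
      = fun _ => 0 := by
    funext t
    have := integral_odd hμinv
      (EuclideanSpace.single i (1:ℝ) + t • EuclideanSpace.single j (1:ℝ))
      (EuclideanSpace.single j (1:ℝ) - t • EuclideanSpace.single i (1:ℝ))
      (by
        simp [inner_add_left, inner_sub_right, inner_smul_left, inner_smul_right,
          EuclideanSpace.inner_single_left, hij, hij.symm]) h hcont
    simpa only [inner_add_right, inner_sub_right, inner_smul_right, sphere_coord_eq] using this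
  rw [hz] at key
  have := key.unique (hasDerivAt_const _ _)
  simp only [zero_mul, add_zero, sub_zero] at this
  rw [integral_add (aux_integrable μ (by fun_prop)) (aux_integrable μ (by fun_prop))] at this
  simp only [mul_neg, integral_neg] at this
  simp only [pow_two, ← mul_assoc]
  linarith

lemma integral_parts
    (hμinv : ∀ e : EuclideanSpace ℝ (Fin N) ≃ₗᵢ[ℝ] EuclideanSpace ℝ (Fin N),
      Measure.map (sphereMap e) μ = μ)
    (h h' : ℝ → ℝ) (hh : ∀ x, HasDerivAt h (h' x) x) (hc : Continuous h') (i : Fin N) :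
    ∫ τ : UnitSphere N, h' (τ.1 i) * (1 - τ.1 i ^ 2) ∂μ =
      ((N : ℝ) - 1) * ∫ τ : UnitSphere N, h (τ.1 i) * τ.1 i ∂μ := by
  have hco : ∀ k : Fin N, Continuous (fun τ : UnitSphere N => τ.1 k) := fun k => by fun_prop
  have e : ∀ τ : UnitSphere N, h' (τ.1 i) * (1 - τ.1 i ^ 2) =
      ∑ j ∈ Finset.univ.erase i, h' (τ.1 i) * τ.1 j ^ 2 := fun τ => by
    rw [← Finset.mul_sum, ← sphere_sum_sq τ, ← Finset.add_sum_erase _ _ (Finset.mem_univ i)]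
    ring
  simp_rw [e]
  rw [integral_finsetSum _ (fun j _ => aux_integrable μ (by fun_prop))]
  rw [Finset.sum_congr rfl fun j hj => integral_parts_two hμinv h h' hh hc i j
    (Finset.ne_of_mem_erase hj).symm]
  have hN : 1 ≤ N := Nat.one_le_iff_ne_zero.2 (fun h => by subst h; exact i.elim0)
  simp [Finset.card_erase_of_mem, Nat.cast_sub hN]

end sphere

lemma angle_parts (N : ℕ) (hN : 2 ≤ N) (h h' : ℝ → ℝ) (hh : ∀ x, HasDerivAt h (h' x) x)
    (hc : Continuous h') :
    ∫ θ in (0:ℝ)..π, h' (cos θ) * (1 - cos θ ^ 2) * sin θ ^ (N - 2) =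
      ((N : ℝ) - 1) * ∫ θ in (0:ℝ)..π, h (cos θ) * cos θ * sin θ ^ (N - 2) := by
  have hcont : Continuous h := continuous_iff_continuousAt.2 fun x => (hh x).continuousAt
  obtain ⟨M, rfl⟩ : ∃ M, N = M + 2 := ⟨N - 2, by omega⟩
  have hd : ∀ θ ∈ Set.uIcc (0:ℝ) π, HasDerivAt (fun θ => h (cos θ) * sin θ ^ (M + 1))
      (h' (cos θ) * (- sin θ) * sin θ ^ (M + 1) +
        h (cos θ) * (((M + 1 : ℕ) : ℝ) * sin θ ^ M * cos θ)) θ := fun θ _ => by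
    have := ((hh (cos θ)).comp θ (hasDerivAt_cos θ)).mul ((hasDerivAt_sin θ).pow (M + 1))
    exact this.congr_deriv (by simp)
  have := intervalIntegral.integral_eq_sub_of_hasDerivAt hd
    (Continuous.intervalIntegrable (by fun_prop) _ _)
  simp only [sin_pi, sin_zero, ne_eq, Nat.add_eq_zero_iff, one_ne_zero, and_false,
    not_false_eq_true, zero_pow, mul_zero, sub_zero] at this
  rw [intervalIntegral.integral_add (Continuous.intervalIntegrable (by fun_prop) _ _)
    (Continuous.intervalIntegrable (by fun_prop) _ _)] at this
  rw [← intervalIntegral.integral_const_mul]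
  have e1 : ∀ θ, h' (cos θ) * (1 - cos θ ^ 2) * sin θ ^ (M + 2 - 2) =
      -(h' (cos θ) * (- sin θ) * sin θ ^ (M + 1)) := fun θ => by
    rw [← sin_sq, Nat.add_sub_cancel]; ring
  have e2 : ∀ θ, (((M + 2 : ℕ) : ℝ) - 1) * (h (cos θ) * cos θ * sin θ ^ (M + 2 - 2)) =
      h (cos θ) * (((M + 1 : ℕ) : ℝ) * sin θ ^ M * cos θ) := fun θ => by
    rw [Nat.add_sub_cancel]; push_cast; ring
  simp_rw [e1, e2]
  rw [intervalIntegral.integral_neg]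
  linarith

section sphere
variable {N : ℕ} {μ : Measure (UnitSphere N)} [IsProbabilityMeasure μ]

lemma moments_eq (hN : 2 ≤ N)
    (hμinv : ∀ e : EuclideanSpace ℝ (Fin N) ≃ₗᵢ[ℝ] EuclideanSpace ℝ (Fin N),
      Measure.map (sphereMap e) μ = μ) (i : Fin N) (k : ℕ) :
    (∫ τ : UnitSphere N, τ.1 i ^ k ∂μ) * (∫ θ in (0:ℝ)..π, sin θ ^ (N - 2)) =
      ∫ θ in (0:ℝ)..π, cos θ ^ k * sin θ ^ (N - 2) := by
  have hN' : (2 : ℝ) ≤ N := by exact_mod_cast hN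
  have hco : Continuous (fun τ : UnitSphere N => τ.1 i) := by fun_prop
  induction k using Nat.twoStepInduction with
  | zero => simp
  | one =>
    have h1 := integral_parts hμinv (fun _ => 1) (fun _ => 0) (fun x => hasDerivAt_const _ _)
      continuous_const i
    have h2 := angle_parts N hN (fun _ => 1) (fun _ => 0) (fun x => hasDerivAt_const _ _)
      continuous_const
    have hne : (N : ℝ) - 1 ≠ 0 := by linarith
    simp only [zero_mul, integral_zero, one_mul, intervalIntegral.integral_zero] at h1 h2
    have h1' := (mul_eq_zero.1 h1.symm).resolve_left hne
    have h2' := (mul_eq_zero.1 h2.symm).resolve_left hne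
    simp only [pow_one, h1', h2', zero_mul]
  | more k ih _ =>
    have hd : ∀ x : ℝ, HasDerivAt (fun x : ℝ => x ^ (k + 1)) ((k + 1 : ℝ) * x ^ k) x := fun x => by
      simpa using hasDerivAt_pow (k + 1) x
    have h1 := integral_parts hμinv _ _ hd (by fun_prop) i
    have h2 := angle_parts N hN _ _ hd (by fun_prop)
    have e1 : ∫ τ : UnitSphere N, (k + 1 : ℝ) * τ.1 i ^ k * (1 - τ.1 i ^ 2) ∂μ =
      (k + 1 : ℝ) * (∫ τ : UnitSphere N, τ.1 i ^ k ∂μ - ∫ τ : UnitSphere N, τ.1 i ^ (k + 2) ∂μ) := by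
      rw [← integral_sub (aux_integrable μ (by fun_prop)) (aux_integrable μ (by fun_prop)),
        ← integral_const_mul]
      congr 1; funext τ; ring
    have e2 : ∫ θ in (0:ℝ)..π, (k + 1 : ℝ) * cos θ ^ k * (1 - cos θ ^ 2) * sin θ ^ (N - 2) =
      (k + 1 : ℝ) * ((∫ θ in (0:ℝ)..π, cos θ ^ k * sin θ ^ (N - 2)) -
        ∫ θ in (0:ℝ)..π, cos θ ^ (k + 2) * sin θ ^ (N - 2)) := by
      rw [← intervalIntegral.integral_sub (Continuous.intervalIntegrable (by fun_prop) _ _)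
        (Continuous.intervalIntegrable (by fun_prop) _ _), ← intervalIntegral.integral_const_mul]
      congr 1; funext τ; ring
    rw [e1] at h1
    rw [e2] at h2
    simp only [← pow_succ] at h1 h2
    have hpos : (0 : ℝ) < N + k := by positivity
    have hne : (N : ℝ) + k ≠ 0 := hpos.ne'
    apply mul_left_cancel₀ hne
    simp only [show k + 1 + 1 = k + 2 from rfl] at *
    linear_combination (-(∫ θ in (0:ℝ)..π, sin θ ^ (N - 2))) * h1 + h2 + (k + 1 : ℝ) * ih

lemma sphere_angle (hN : 2 ≤ N)
    (hμinv : ∀ e : EuclideanSpace ℝ (Fin N) ≃ₗᵢ[ℝ] EuclideanSpace ℝ (Fin N),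
      Measure.map (sphereMap e) μ = μ) (i : Fin N) (F : ℝ → ℝ) (hF : Continuous F) :
    (∫ τ : UnitSphere N, F (τ.1 i) ∂μ) * (∫ θ in (0:ℝ)..π, sin θ ^ (N - 2)) =
      ∫ θ in (0:ℝ)..π, F (cos θ) * sin θ ^ (N - 2) := by
  have hco : Continuous (fun τ : UnitSphere N => τ.1 i) := by fun_prop
  have hpoly : ∀ p : Polynomial ℝ,
      (∫ τ : UnitSphere N, p.eval (τ.1 i) ∂μ) * (∫ θ in (0:ℝ)..π, sin θ ^ (N - 2)) =
      ∫ θ in (0:ℝ)..π, p.eval (cos θ) * sin θ ^ (N - 2) := by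
    intro p
    induction p using Polynomial.induction_on' with
    | add p q hp hq =>
      simp only [Polynomial.eval_add, add_mul]
      rw [integral_add (aux_integrable μ (by fun_prop)) (aux_integrable μ (by fun_prop)),
        intervalIntegral.integral_add (Continuous.intervalIntegrable (by fun_prop) _ _)
        (Continuous.intervalIntegrable (by fun_prop) _ _), add_mul, hp, hq]
    | monomial k a =>
      simp only [Polynomial.eval_monomial, mul_assoc]
      rw [integral_const_mul, intervalIntegral.integral_const_mul, mul_assoc,
        moments_eq hN hμinv]
  have hτ : ∀ τ : UnitSphere N, τ.1 i ∈ Set.Icc (-1:ℝ) 1 := fun τ => by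
    have := sphere_sum_sq τ
    have h2 := Finset.single_le_sum (f := fun i => τ.1 i ^ 2) (fun j _ => sq_nonneg _)
      (Finset.mem_univ i)
    simp only at h2
    rw [this] at h2
    exact ⟨by nlinarith, by nlinarith⟩
  set A := ∫ θ in (0:ℝ)..π, sin θ ^ (N - 2) with hA
  rw [← sub_eq_zero, ← abs_eq_zero]
  apply le_antisymm _ (abs_nonneg _)
  apply le_of_forall_pos_le_add
  intro ε hε
  have hδ : 0 < ε / (|A| + π + 1) := by positivity
  obtain ⟨p, hp⟩ := exists_polynomial_near_of_continuousOn (-1) 1 F hF.continuousOn _ hδ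
  set δ := ε / (|A| + π + 1) with hδdef
  have b1 : |(∫ τ : UnitSphere N, F (τ.1 i) ∂μ) - ∫ τ : UnitSphere N, p.eval (τ.1 i) ∂μ| ≤ δ := by
    rw [← integral_sub (aux_integrable μ (by fun_prop)) (aux_integrable μ (by fun_prop))]
    have := norm_integral_le_of_norm_le_const (μ := μ) (C := δ)
      (f := fun τ : UnitSphere N => F (τ.1 i) - p.eval (τ.1 i))
      (Filter.Eventually.of_forall fun τ => by
        rw [Real.norm_eq_abs, abs_sub_comm]; exact (hp _ (hτ τ)).le)
    simpa using this
  have b2 : |(∫ θ in (0:ℝ)..π, F (cos θ) * sin θ ^ (N - 2)) -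
      ∫ θ in (0:ℝ)..π, p.eval (cos θ) * sin θ ^ (N - 2)| ≤ δ * π := by
    rw [← intervalIntegral.integral_sub (Continuous.intervalIntegrable (by fun_prop) _ _)
        (Continuous.intervalIntegrable (by fun_prop) _ _)]
    have := intervalIntegral.norm_integral_le_of_norm_le_const (a := 0) (b := π) (C := δ)
      (f := fun θ => F (cos θ) * sin θ ^ (N - 2) - p.eval (cos θ) * sin θ ^ (N - 2))
      (fun θ _ => by
        rw [← sub_mul, norm_mul, norm_pow, Real.norm_eq_abs, Real.norm_eq_abs, abs_sub_comm]
        have h1 := (hp _ ⟨neg_one_le_cos θ, cos_le_one θ⟩).le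
        have h2 : |sin θ| ^ (N - 2) ≤ 1 := pow_le_one₀ (abs_nonneg _) (abs_sin_le_one θ)
        have h3 : 0 ≤ |sin θ| ^ (N - 2) := by positivity
        have h4 := abs_nonneg (p.eval (cos θ) - F (cos θ))
        nlinarith)
    rwa [Real.norm_eq_abs, sub_zero, abs_of_pos pi_pos] at this
  have hp' := hpoly p
  have : (∫ τ : UnitSphere N, F (τ.1 i) ∂μ) * A - ∫ θ in (0:ℝ)..π, F (cos θ) * sin θ ^ (N - 2) =
    ((∫ τ : UnitSphere N, F (τ.1 i) ∂μ) - ∫ τ : UnitSphere N, p.eval (τ.1 i) ∂μ) * A -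
    ((∫ θ in (0:ℝ)..π, F (cos θ) * sin θ ^ (N - 2)) -
      ∫ θ in (0:ℝ)..π, p.eval (cos θ) * sin θ ^ (N - 2)) := by
    rw [← hp']; ring
  rw [this, zero_add]
  refine (abs_sub _ _).trans ?_
  rw [abs_mul]
  have h5 : δ * |A| + δ * π + δ = ε := by rw [hδdef]; field_simp
  nlinarith [abs_nonneg A]

/-- tilted moments -/
def tiltM (N : ℕ) (μ : Measure (UnitSphere N)) (i : Fin N) (k : ℕ) (x : ℝ) : ℝ :=
  ∫ τ : UnitSphere N, τ.1 i ^ k * exp (x * τ.1 i) ∂μ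

def tiltP (N : ℕ) (μ : Measure (UnitSphere N)) (i : Fin N) (k : ℕ) (x : ℝ) : ℝ :=
  tiltM N μ i k x / tiltM N μ i 0 x

lemma tiltM_zero_pos (i : Fin N) (x : ℝ) : 0 < tiltM N μ i 0 x := by
  have hco : Continuous (fun τ : UnitSphere N => τ.1 i) := by fun_prop
  simp only [tiltM, pow_zero, one_mul]
  exact integral_exp_pos (aux_integrable μ (by fun_prop))

lemma coord_abs_le (τ : UnitSphere N) (i : Fin N) : |τ.1 i| ≤ 1 := by
  have := sphere_sum_sq τ
  have h2 := Finset.single_le_sum (f := fun i => τ.1 i ^ 2) (fun j _ => sq_nonneg _)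
    (Finset.mem_univ i)
  simp only at h2
  rw [this] at h2
  exact abs_le.2 ⟨by nlinarith, by nlinarith⟩

lemma tiltP_abs_le (i : Fin N) (k : ℕ) (x : ℝ) : |tiltP N μ i k x| ≤ 1 := by
  have hco : Continuous (fun τ : UnitSphere N => τ.1 i) := by fun_prop
  rw [tiltP, abs_div, abs_of_pos (tiltM_zero_pos i x), div_le_one (tiltM_zero_pos i x)]
  simp only [tiltM]
  refine (abs_integral_le_integral_abs).trans ?_
  refine integral_mono (aux_integrable μ (by fun_prop)) (aux_integrable μ (by fun_prop)) ?_
  intro τ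
  simp only [abs_mul, abs_pow, pow_zero, abs_exp]
  gcongr
  exact pow_le_one₀ (abs_nonneg _) (coord_abs_le τ i)

lemma tiltM_hasDerivAt (i : Fin N) (k : ℕ) (x : ℝ) :
    HasDerivAt (tiltM N μ i k) (tiltM N μ i (k + 1) x) x := by
  have hco : Continuous (fun τ : UnitSphere N => τ.1 i) := by fun_prop
  have hco' : Continuous (fun τ : ℝ × UnitSphere N => τ.2.1 i) := by fun_prop
  refine aux_hasDerivAt_integral μ (fun x τ => τ.1 i ^ k * exp (x * τ.1 i))
    (fun x τ => τ.1 i ^ (k + 1) * exp (x * τ.1 i)) (fun t => by fun_prop)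
    (by simp only [Function.uncurry_def]; fun_prop) ?_ x
  intro t τ
  have := (((hasDerivAt_id t).mul_const (τ.1 i)).exp).const_mul (τ.1 i ^ k)
  refine this.congr_deriv ?_
  simp only [id, one_mul]
  ring

lemma tiltP_hasDerivAt (i : Fin N) (k : ℕ) (x : ℝ) :
    HasDerivAt (tiltP N μ i k) (tiltP N μ i (k + 1) x - tiltP N μ i k x * tiltP N μ i 1 x) x := by
  have := (tiltM_hasDerivAt (μ := μ) i k x).div (tiltM_hasDerivAt (μ := μ) i 0 x)
    (tiltM_zero_pos i x).ne'
  refine this.congr_deriv ?_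
  have := (tiltM_zero_pos (μ := μ) i x).ne'
  simp only [tiltP]
  field_simp

lemma tiltP_lip (i : Fin N) (k : ℕ) (x y : ℝ) :
    |tiltP N μ i k x - tiltP N μ i k y| ≤ 2 * |x - y| := by
  have := Convex.norm_image_sub_le_of_norm_hasDerivWithin_le (C := 2) (s := Set.univ)
    (f := tiltP N μ i k) (fun x _ => (tiltP_hasDerivAt i k x).hasDerivWithinAt) (fun x _ => by
      rw [Real.norm_eq_abs]
      refine (abs_sub _ _).trans ?_
      rw [abs_mul]
      have h1 := tiltP_abs_le (μ := μ) i k x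
      have h2 := tiltP_abs_le (μ := μ) i 1 x
      have h3 := tiltP_abs_le (μ := μ) i (k + 1) x
      nlinarith [abs_nonneg (tiltP N μ i k x), abs_nonneg (tiltP N μ i 1 x)]) convex_univ
      (Set.mem_univ y) (Set.mem_univ x)
  simpa using this

lemma tiltM_parts 
    (hμinv : ∀ e : EuclideanSpace ℝ (Fin N) ≃ₗᵢ[ℝ] EuclideanSpace ℝ (Fin N),
      Measure.map (sphereMap e) μ = μ) (i : Fin N) (x : ℝ) :
    x * (tiltM N μ i 0 x - tiltM N μ i 2 x) = ((N : ℝ) - 1) * tiltM N μ i 1 x := by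
  have hco : Continuous (fun τ : UnitSphere N => τ.1 i) := by fun_prop
  have := integral_parts hμinv (fun u => exp (x * u)) (fun u => exp (x * u) * x)
    (fun u => by simpa using ((hasDerivAt_id u).const_mul x).exp) (by fun_prop) i
  simp only [tiltM]
  rw [← integral_sub (aux_integrable μ (by fun_prop)) (aux_integrable μ (by fun_prop)),
        ← integral_const_mul]
  refine Eq.trans (integral_congr_ae (Filter.Eventually.of_forall fun τ => ?_)) (this.trans ?_)
  · simp only; ring
  · congr 1
    refine integral_congr_ae (Filter.Eventually.of_forall fun τ => ?_)
    simp only; ring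

lemma besselRatio_eq (hN : 2 ≤ N)
    (hμinv : ∀ e : EuclideanSpace ℝ (Fin N) ≃ₗᵢ[ℝ] EuclideanSpace ℝ (Fin N),
      Measure.map (sphereMap e) μ = μ) (i : Fin N) :
    besselRatio N = tiltP N μ i 1 := by
  funext x
  have hco : Continuous (fun τ : UnitSphere N => τ.1 i) := by fun_prop
  have hN' : (2 : ℝ) ≤ N := by exact_mod_cast hN
  have h1 := sphere_angle hN hμinv i (fun u => exp (x * u)) (by fun_prop)
  have h2 := sphere_angle hN hμinv i (fun u => exp (x * u) * (1 - u ^ 2)) (by fun_prop)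
  have hM := tiltM_parts hμinv i x
  have e : ∫ τ : UnitSphere N, exp (x * τ.1 i) * (1 - τ.1 i ^ 2) ∂μ =
      tiltM N μ i 0 x - tiltM N μ i 2 x := by
    simp only [tiltM]
    rw [← integral_sub (aux_integrable μ (by fun_prop)) (aux_integrable μ (by fun_prop))]
    congr 1; funext τ; ring
  have e0 : ∫ τ : UnitSphere N, exp (x * τ.1 i) ∂μ = tiltM N μ i 0 x := by
    simp [tiltM]
  have e3 : ∫ θ in (0:ℝ)..π, exp (x * cos θ) * (1 - cos θ ^ 2) * sin θ ^ (N - 2) =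
      ∫ θ in (0:ℝ)..π, exp (x * cos θ) * sin θ ^ N := by
    congr 1; funext θ
    rw [← sin_sq, mul_assoc, ← pow_add]
    congr 2; omega
  have hA : 0 < ∫ θ in (0:ℝ)..π, sin θ ^ (N - 2) := integral_sin_pow_pos _
  rw [e0] at h1
  simp only at h2
  rw [e, e3] at h2
  rw [besselRatio, ← h1, ← h2, tiltP]
  have hpos := tiltM_zero_pos (μ := μ) i x
  have : (N : ℝ) - 1 ≠ 0 := by linarith
  have h3 := hpos.ne'
  have h4 := hA.ne'
  have h5 : tiltM N μ i 1 x = x * (tiltM N μ i 0 x - tiltM N μ i 2 x) / ((N : ℝ) - 1) := by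
    rw [hM]; field_simp
  rw [h5]
  field_simp

lemma tilt_vec (k : ℕ)
    (hμinv : ∀ e : EuclideanSpace ℝ (Fin N) ≃ₗᵢ[ℝ] EuclideanSpace ℝ (Fin N),
      Measure.map (sphereMap e) μ = μ) (i : Fin N) (a : EuclideanSpace ℝ (Fin N)) (β : ℝ) :
    ∫ τ : UnitSphere N, ⟪(τ : EuclideanSpace ℝ (Fin N)), a⟫ ^ k *
      exp (β * ⟪(τ : EuclideanSpace ℝ (Fin N)), a⟫) ∂μ = ‖a‖ ^ k * tiltM N μ i k (β * ‖a‖) := by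
  rw [integral_unit hμinv a (‖a‖ • EuclideanSpace.single i (1:ℝ)) (by simp [norm_smul])
    (fun u => u ^ k * exp (β * u)) (by fun_prop), tiltM, ← integral_const_mul]
  congr 1; funext τ
  rw [inner_smul_right, sphere_coord_eq]
  ring_nf

end sphere

lemma cosh_cross {x y u c : ℝ} (hx : 0 ≤ x) (hxy : x ≤ y) (hu : 0 ≤ u) (huc : u ≤ c) :
    cosh (x * c) * cosh (y * u) ≤ cosh (y * c) * cosh (x * u) := by
  have e : ∀ a b : ℝ, cosh a * cosh b = (cosh (a + b) + cosh (a - b)) / 2 := fun a b => by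
    rw [cosh_add, cosh_sub]; ring
  rw [e, e]
  have h1 : cosh (x * c + y * u) ≤ cosh (y * c + x * u) := by
    rw [cosh_le_cosh]
    rw [abs_of_nonneg (by nlinarith [mul_nonneg hx (hu.trans huc)]),
      abs_of_nonneg (by nlinarith [mul_nonneg hx (hu.trans huc)])]
    nlinarith
  have h2 : cosh (x * c - y * u) ≤ cosh (y * c - x * u) := by
    rw [cosh_le_cosh]
    have h0 : 0 ≤ y * c - x * u := by nlinarith
    rw [abs_of_nonneg h0, abs_le]
    constructor <;> nlinarith
  linarith

lemma cosh_cross_sq {x y u c : ℝ} (hx : 0 ≤ x) (hxy : x ≤ y) :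
    0 ≤ (u ^ 2 - c ^ 2) * (cosh (x * c) * cosh (y * u) - cosh (y * c) * cosh (x * u)) := by
  have e : ∀ z w : ℝ, 0 ≤ z → cosh (z * w) = cosh (z * |w|) := fun z w hz => by
    rw [← cosh_abs, abs_mul, abs_of_nonneg hz]
  have hy := hx.trans hxy
  rw [e x c hx, e y u hy, e y c hy, e x u hx, ← sq_abs u, ← sq_abs c]
  have hu := abs_nonneg u
  have hc := abs_nonneg c
  rcases le_total |u| |c| with h | h
  · have := cosh_cross hx hxy hu h
    exact mul_nonneg_of_nonpos_of_nonpos (by nlinarith) (by linarith)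
  · have := cosh_cross hx hxy hc h
    exact mul_nonneg (by nlinarith) (by nlinarith)

lemma exp_to_cosh (k : ℕ) (x : ℝ) :
    ∫ θ in (0:ℝ)..π, exp (x * cos θ) * sin θ ^ k =
    ∫ θ in (0:ℝ)..π, cosh (x * cos θ) * sin θ ^ k := by
  have h := intervalIntegral.integral_comp_sub_left (a := 0) (b := π)
    (fun θ => exp (x * cos θ) * sin θ ^ k) π
  simp only [cos_pi_sub, sin_pi_sub, sub_self, sub_zero] at h
  have : ∫ θ in (0:ℝ)..π, cosh (x * cos θ) * sin θ ^ k =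
      ((∫ θ in (0:ℝ)..π, exp (x * cos θ) * sin θ ^ k) +
        ∫ θ in (0:ℝ)..π, exp (x * -cos θ) * sin θ ^ k) / 2 := by
    rw [← intervalIntegral.integral_add (Continuous.intervalIntegrable (by fun_prop) _ _)
        (Continuous.intervalIntegrable (by fun_prop) _ _), ← intervalIntegral.integral_div]
    congr 1; funext θ
    rw [cosh_eq]; ring_nf
  rw [this, h]; ring

lemma ratio_strict (M : ℕ) {x y : ℝ} (hx : 0 < x) (hxy : x < y) :
    (∫ θ in (0:ℝ)..π, cos θ ^ 2 * cosh (x * cos θ) * sin θ ^ M) *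
      (∫ θ in (0:ℝ)..π, cosh (y * cos θ) * sin θ ^ M) <
    (∫ θ in (0:ℝ)..π, cos θ ^ 2 * cosh (y * cos θ) * sin θ ^ M) *
      (∫ θ in (0:ℝ)..π, cosh (x * cos θ) * sin θ ^ M) := by
  have hs : ∀ θ ∈ Set.Ioc (0:ℝ) π, 0 ≤ sin θ := fun θ h =>
    sin_nonneg_of_nonneg_of_le_pi h.1.le h.2
  have hs2 : (π / 2) ∈ Set.Icc (0:ℝ) π := ⟨by positivity, by linarith [pi_pos]⟩
  have hs4 : (π / 4) ∈ Set.Icc (0:ℝ) π := ⟨by positivity, by linarith [pi_pos]⟩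
  have hB : 0 < ∫ θ in (0:ℝ)..π, cosh (x * cos θ) * sin θ ^ M := by
    refine intervalIntegral.integral_pos pi_pos (by fun_prop) (fun θ hθ => ?_) ⟨π / 2, hs2, ?_⟩
    · have := hs θ hθ; have := cosh_pos (x * cos θ); positivity
    · have := cosh_pos (x * cos (π / 2)); simp
  have hC : 0 < ∫ θ in (0:ℝ)..π, cos θ ^ 2 * cosh (x * cos θ) * sin θ ^ M := by
    refine intervalIntegral.integral_pos pi_pos (by fun_prop) (fun θ hθ => ?_) ⟨π / 4, hs4, ?_⟩
    · have := hs θ hθ; have := cosh_pos (x * cos θ); positivity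
    · have := cosh_pos (x * cos (π / 4))
      have h1 : 0 < cos (π / 4) := by rw [cos_pi_div_four]; positivity
      have h2 : 0 < sin (π / 4) := by rw [sin_pi_div_four]; positivity
      positivity
  set B := ∫ θ in (0:ℝ)..π, cosh (x * cos θ) * sin θ ^ M
  set C := ∫ θ in (0:ℝ)..π, cos θ ^ 2 * cosh (x * cos θ) * sin θ ^ M
  set c := √(C / B) with hc
  have hcpos : 0 < c := by rw [hc]; positivity
  have hc2 : c ^ 2 = C / B := by rw [hc]; exact sq_sqrt (by positivity)
  have key : 0 < ∫ θ in (0:ℝ)..π, (cos θ ^ 2 - c ^ 2) *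
      (cosh (x * c) * cosh (y * cos θ) - cosh (y * c) * cosh (x * cos θ)) * sin θ ^ M := by
    refine intervalIntegral.integral_pos pi_pos (by fun_prop) (fun θ hθ => ?_) ⟨π / 2, hs2, ?_⟩
    · exact mul_nonneg (cosh_cross_sq hx.le hxy.le) (pow_nonneg (hs θ hθ) _)
    · simp only [cos_pi_div_two, sin_pi_div_two, mul_zero, cosh_zero, one_pow, mul_one]
      have : cosh (x * c) < cosh (y * c) := by
        rw [cosh_lt_cosh, abs_of_pos (by positivity), abs_of_pos (by nlinarith)]
        nlinarith
      nlinarith [pow_pos hcpos 2]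
  have e : ∫ θ in (0:ℝ)..π, (cos θ ^ 2 - c ^ 2) *
      (cosh (x * c) * cosh (y * cos θ) - cosh (y * c) * cosh (x * cos θ)) * sin θ ^ M =
      cosh (x * c) * ((∫ θ in (0:ℝ)..π, cos θ ^ 2 * cosh (y * cos θ) * sin θ ^ M) -
        c ^ 2 * ∫ θ in (0:ℝ)..π, cosh (y * cos θ) * sin θ ^ M) -
      cosh (y * c) * (C - c ^ 2 * B) := by
    simp only [B, C]
    simp only [← intervalIntegral.integral_const_mul]
    rw [← intervalIntegral.integral_sub (Continuous.intervalIntegrable (by fun_prop) _ _)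
        (Continuous.intervalIntegrable (by fun_prop) _ _),
      ← intervalIntegral.integral_sub (Continuous.intervalIntegrable (by fun_prop) _ _)
        (Continuous.intervalIntegrable (by fun_prop) _ _)]
    simp only [← intervalIntegral.integral_const_mul]
    rw [← intervalIntegral.integral_sub (Continuous.intervalIntegrable (by fun_prop) _ _)
        (Continuous.intervalIntegrable (by fun_prop) _ _)]
    congr 1; funext θ; ring
  have hz : C - c ^ 2 * B = 0 := by rw [hc2]; field_simp; ring
  rw [e, hz, mul_zero, sub_zero] at key
  have := pos_of_mul_pos_right key (cosh_pos _).le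
  rw [hc2] at this
  have h3 := mul_pos this hB
  have h4 : ∀ P Q : ℝ, (P - C / B * Q) * B = P * B - C * Q := fun P Q => by field_simp
  rw [h4] at h3
  linarith

lemma bessel_fix_unique (N : ℕ) (hN : 2 ≤ N) (β x y : ℝ) (hx : 0 < x) (hxy : x < y)
    (h1 : x = β * besselRatio N x) (h2 : y = β * besselRatio N y) : False := by
  have hN' : (2 : ℝ) ≤ N := by exact_mod_cast hN
  obtain ⟨M, rfl⟩ : ∃ M, N = M + 2 := ⟨N - 2, by omega⟩
  have e : ∀ z : ℝ, ∫ θ in (0:ℝ)..π, exp (z * cos θ) * sin θ ^ (M + 2) =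
      (∫ θ in (0:ℝ)..π, cosh (z * cos θ) * sin θ ^ M) -
      ∫ θ in (0:ℝ)..π, cos θ ^ 2 * cosh (z * cos θ) * sin θ ^ M := fun z => by
    rw [exp_to_cosh, ← intervalIntegral.integral_sub
      (Continuous.intervalIntegrable (by fun_prop) _ _)
      (Continuous.intervalIntegrable (by fun_prop) _ _)]
    congr 1; funext θ
    rw [pow_add, sin_sq]; ring
  have hB : ∀ z : ℝ, 0 < ∫ θ in (0:ℝ)..π, cosh (z * cos θ) * sin θ ^ M := fun z => by
    refine intervalIntegral.integral_pos pi_pos (by fun_prop) (fun θ hθ => ?_)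
      ⟨π / 2, ⟨by positivity, by linarith [pi_pos]⟩, ?_⟩
    · have := sin_nonneg_of_nonneg_of_le_pi hθ.1.le hθ.2
      have := cosh_pos (z * cos θ); positivity
    · simp
  have hr := ratio_strict M hx hxy
  simp only [besselRatio, e, Nat.add_sub_cancel, exp_to_cosh M] at h1 h2
  have hBx := hB x
  have hBy := hB y
  set Bx := ∫ θ in (0:ℝ)..π, cosh (x * cos θ) * sin θ ^ M
  set By := ∫ θ in (0:ℝ)..π, cosh (y * cos θ) * sin θ ^ M
  set Cx := ∫ θ in (0:ℝ)..π, cos θ ^ 2 * cosh (x * cos θ) * sin θ ^ M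
  set Cy := ∫ θ in (0:ℝ)..π, cos θ ^ 2 * cosh (y * cos θ) * sin θ ^ M
  have hne : ((M + 2 : ℕ) : ℝ) - 1 ≠ 0 := by linarith
  set K := ((M + 2 : ℕ) : ℝ) - 1
  have hy : 0 < y := hx.trans hxy
  have h1' : K * Bx = β * (Bx - Cx) := by
    field_simp at h1; nlinarith
  have h2' : K * By = β * (By - Cy) := by
    field_simp at h2; nlinarith
  have hK : 0 < K := by simp only [K]; linarith
  have hβ : β ≠ 0 := by
    rintro rfl
    rw [zero_mul] at h1
    exact hx.ne' h1
  have : β * (Cx * By - Cy * Bx) = 0 := by linear_combination By * h1' - Bx * h2'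
  have := (mul_eq_zero.1 this).resolve_left hβ
  linarith

section sphere
variable {N : ℕ} {μ : Measure (UnitSphere N)} [IsProbabilityMeasure μ]

lemma phi_lower (hN : 2 ≤ N)
    (hμinv : ∀ e : EuclideanSpace ℝ (Fin N) ≃ₗᵢ[ℝ] EuclideanSpace ℝ (Fin N),
      Measure.map (sphereMap e) μ = μ) (i : Fin N)
    (β : ℝ) (hβ : 0 < β) (b : ℝ) (hb : 0 < b) (hbfix : b = β * besselRatio N b)
    (hne : 1 - β * deriv (besselRatio N) b ≠ 0) (δ : ℝ) (hδ : 0 < δ) :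
    ∃ c > 0, ∀ t ∈ Set.Icc δ 1, c * |t - b / β| ≤ |t ^ 2 - t * tiltP N μ i 1 (β * t)| := by
  have hbe := besselRatio_eq hN hμinv i
  set r := b / β with hr
  have hrpos : 0 < r := by positivity
  have hβr : β * r = b := by rw [hr]; field_simp
  set φ : ℝ → ℝ := fun t => t ^ 2 - t * tiltP N μ i 1 (β * t) with hφ
  have hdp : ∀ x, HasDerivAt (tiltP N μ i 1) (deriv (besselRatio N) x) x := fun x => by
    rw [hbe]; exact (tiltP_hasDerivAt i 1 x).differentiableAt.hasDerivAt
  have hd : ∀ t, HasDerivAt φ (2 * t - (tiltP N μ i 1 (β * t) +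
      t * (deriv (besselRatio N) (β * t) * β))) t := fun t => by
    have h1 : HasDerivAt (fun t => tiltP N μ i 1 (β * t)) (deriv (besselRatio N) (β * t) * β) t :=
      (hdp (β * t)).comp t (by simpa using (hasDerivAt_id t).const_mul β)
    have := (hasDerivAt_pow 2 t).sub ((hasDerivAt_id t).mul h1)
    exact this.congr_deriv (by simp)
  have hfr : tiltP N μ i 1 b = r := by
    rw [← hbe, hr]; field_simp; linarith
  have hφr : φ r = 0 := by simp only [hφ, hβr, hfr]; ring
  have hcont : Continuous (dslope φ r) := by
    rw [← continuousOn_univ, continuousOn_dslope Filter.univ_mem]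
    exact ⟨fun t _ => (hd t).continuousAt.continuousWithinAt, (hd r).differentiableAt⟩
  have hnz : ∀ t ∈ Set.Icc δ 1, dslope φ r t ≠ 0 := by
    intro t ht
    by_cases htr : t = r
    · subst htr
      rw [dslope_same, (hd _).deriv, hβr, hfr]
      have : 2 * r - (r + r * (deriv (besselRatio N) b * β)) =
        r * (1 - β * deriv (besselRatio N) b) := by ring
      rw [this]
      exact mul_ne_zero hrpos.ne' hne
    · rw [dslope_of_ne _ htr, slope_def_field, hφr, sub_zero]
      refine div_ne_zero ?_ (sub_ne_zero.2 htr)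
      intro h0
      have ht0 : 0 < t := hδ.trans_le ht.1
      have h1 : t * (t - tiltP N μ i 1 (β * t)) = 0 := by rw [← h0]; simp only [hφ]; ring
      have h2 := (mul_eq_zero.1 h1).resolve_left ht0.ne'
      have h3 : β * t = β * besselRatio N (β * t) := by rw [hbe]; congr 1; linarith
      have h4 : β * t ≠ b := fun h => htr (by rw [hr, ← h]; field_simp)
      rcases lt_or_gt_of_ne h4 with h | h
      · exact bessel_fix_unique N hN β _ _ (by positivity) h h3 hbfix
      · exact bessel_fix_unique N hN β _ _ hb h hbfix h3
  by_cases hne' : (Set.Icc δ (1:ℝ)).Nonempty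
  · obtain ⟨t0, ht0, hmin⟩ := isCompact_Icc.exists_isMinOn hne' hcont.abs.continuousOn
    refine ⟨|dslope φ r t0|, abs_pos.2 (hnz t0 ht0), fun t ht => ?_⟩
    have h1 : |dslope φ r t0| ≤ |dslope φ r t| := hmin ht
    have h2 := sub_smul_dslope φ r t
    rw [hφr, sub_zero, smul_eq_mul] at h2
    change _ ≤ |φ t|
    rw [← h2, abs_mul, mul_comm]
    gcongr
  · exact ⟨1, one_pos, fun t ht => (hne' ⟨t, ht⟩).elim⟩

end sphere

section gibbs
variable {N n : ℕ} {μ : Measure (UnitSphere N)} [IsProbabilityMeasure μ]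

lemma totalSpin_continuous : Continuous (totalSpin : (Fin n → UnitSphere N) → _) := by
  unfold totalSpin; fun_prop

lemma gibbsWeight_eq (β : ℝ) (σ : Fin n → UnitSphere N) :
    gibbsWeight N n β σ = exp (β / (2 * n) * ‖totalSpin σ‖ ^ 2) := by
  rw [gibbsWeight, ← real_inner_self_eq_norm_sq, totalSpin, sum_inner]
  simp only [inner_sum]

lemma gibbsWeight_continuous (β : ℝ) : Continuous (gibbsWeight N n β) := by
  have := totalSpin_continuous (N := N) (n := n)
  have e : gibbsWeight N n β = fun σ => exp (β / (2 * n) * ‖totalSpin σ‖ ^ 2) :=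
    funext (gibbsWeight_eq β)
  rw [e]; fun_prop

lemma gibbsWeight_pos (β : ℝ) (σ : Fin n → UnitSphere N) : 0 < gibbsWeight N n β σ := exp_pos _

def gibbsZ (N n : ℕ) (β : ℝ) (μ : Measure (UnitSphere N)) [IsProbabilityMeasure μ] : ℝ :=
  ∫ τ, gibbsWeight N n β τ ∂(Measure.pi fun _ : Fin n => μ)

lemma gibbsZ_pos (β : ℝ) : 0 < gibbsZ N n β μ := by
  unfold gibbsZ
  have := gibbsWeight_continuous (N := N) (n := n) β
  exact integral_exp_pos (aux_integrable (Measure.pi fun _ : Fin n => μ) this)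

lemma gibbsMeasure_eq (β : ℝ) : gibbsMeasure N n β μ =
    (Measure.pi fun _ : Fin n => μ).withDensity fun σ =>
      ENNReal.ofReal (gibbsWeight N n β σ / gibbsZ N n β μ) := rfl

lemma gibbs_integral (β : ℝ) (F : (Fin n → UnitSphere N) → ℝ) :
    ∫ σ, F σ ∂(gibbsMeasure N n β μ) =
      (∫ σ, gibbsWeight N n β σ * F σ ∂(Measure.pi fun _ : Fin n => μ)) / gibbsZ N n β μ := by
  have hc := gibbsWeight_continuous (N := N) (n := n) β
  have hZ := gibbsZ_pos (N := N) (n := n) (μ := μ) β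
  rw [gibbsMeasure_eq, integral_withDensity_eq_integral_toReal_smul
    (by exact (hc.div_const _).measurable.ennreal_ofReal) (by simp), ← integral_div]
  congr 1; funext σ
  rw [ENNReal.toReal_ofReal (div_nonneg (gibbsWeight_pos β σ).le (gibbsZ_pos β).le)]
  rw [smul_eq_mul]; ring

instance gibbs_prob (β : ℝ) : IsProbabilityMeasure (gibbsMeasure N n β μ) := by
  have hc := gibbsWeight_continuous (N := N) (n := n) β
  have hZ := gibbsZ_pos (N := N) (n := n) (μ := μ) β
  constructor
  rw [gibbsMeasure_eq, withDensity_apply _ MeasurableSet.univ, Measure.restrict_univ,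
    ← ofReal_integral_eq_lintegral_ofReal (aux_integrable _ (hc.div_const _))
    (Filter.Eventually.of_forall fun σ => div_nonneg (gibbsWeight_pos β σ).le (gibbsZ_pos β).le),
    integral_div]
  change ENNReal.ofReal (gibbsZ N n β μ / gibbsZ N n β μ) = 1
  rw [div_self hZ.ne', ENNReal.ofReal_one]

lemma update_continuous (i : Fin n) :
    Continuous (fun p : (Fin n → UnitSphere N) × UnitSphere N => Function.update p.1 i p.2) :=
  continuous_fst.update i continuous_snd

lemma update_integral (i : Fin n) (F : (Fin n → UnitSphere N) → ℝ) (hF : Continuous F) :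
    ∫ σ, F σ ∂(Measure.pi fun _ : Fin n => μ) =
      ∫ σ, ∫ τ, F (Function.update σ i τ) ∂μ ∂(Measure.pi fun _ : Fin n => μ) := by
  have hm : Measure.map (fun p : (Fin n → UnitSphere N) × UnitSphere N =>
      Function.update p.1 i p.2) ((Measure.pi fun _ : Fin n => μ).prod μ) =
      Measure.pi fun _ : Fin n => μ := by
    symm
    apply Measure.pi_eq
    intro s hs
    rw [Measure.map_apply (update_continuous i).measurable (MeasurableSet.univ_pi hs)]
    have : (fun p : (Fin n → UnitSphere N) × UnitSphere N => Function.update p.1 i p.2) ⁻¹'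
        (Set.univ.pi s) = (Set.univ.pi (Function.update s i Set.univ)) ×ˢ (s i) := by
      ext ⟨σ, τ⟩
      simp only [Set.mem_preimage, Set.mem_pi, Set.mem_univ, true_implies, Set.mem_prod]
      constructor
      · intro h
        refine ⟨fun j => ?_, by simpa using h i⟩
        by_cases hj : j = i
        · subst hj; simp
        · simpa [hj] using h j
      · rintro ⟨h1, h2⟩ j
        by_cases hj : j = i
        · subst hj; simpa using h2
        · simpa [hj] using h1 j
    rw [this, Measure.prod_prod, Measure.pi_pi, ← Finset.mul_prod_erase _ _ (Finset.mem_univ i),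
      ← Finset.mul_prod_erase Finset.univ (fun j => μ (s j)) (Finset.mem_univ i)]
    rw [Function.update_self, measure_univ, one_mul, mul_comm]
    congr 1
    refine Finset.prod_congr rfl fun j hj => ?_
    rw [Function.update_of_ne (Finset.ne_of_mem_erase hj)]
  conv_lhs => rw [← hm]
  rw [integral_map (update_continuous i).aemeasurable hF.aestronglyMeasurable]
  exact integral_prod _ (aux_integrable _ (hF.comp (update_continuous i)))

/-- local field -/
def locF (σ : Fin n → UnitSphere N) (i : Fin n) : EuclideanSpace ℝ (Fin N) :=
  (1 / (n : ℝ)) • (totalSpin σ - (σ i : EuclideanSpace ℝ (Fin N)))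

lemma totalSpin_update (σ : Fin n → UnitSphere N) (i : Fin n) (τ : UnitSphere N) :
    totalSpin (Function.update σ i τ) = totalSpin σ - (σ i : EuclideanSpace ℝ (Fin N)) + τ := by
  unfold totalSpin
  rw [← Finset.add_sum_erase _ _ (Finset.mem_univ i),
    ← Finset.add_sum_erase _ (fun j => (σ j : EuclideanSpace ℝ (Fin N))) (Finset.mem_univ i)]
  rw [Function.update_self, add_sub_cancel_left, add_comm]
  congr 1
  refine Finset.sum_congr rfl fun j hj => ?_
  rw [Function.update_of_ne (Finset.ne_of_mem_erase hj)]

lemma locF_update (σ : Fin n → UnitSphere N) (i : Fin n) (τ : UnitSphere N) :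
    locF (Function.update σ i τ) i = locF σ i := by
  simp [locF, totalSpin_update]

lemma sph_norm (τ : UnitSphere N) : ‖(τ : EuclideanSpace ℝ (Fin N))‖ = 1 :=
  mem_sphere_zero_iff_norm.mp τ.2

lemma locF_norm_le (σ : Fin n → UnitSphere N) (i : Fin n) : ‖locF σ i‖ ≤ 1 := by
  have hn : 0 < (n : ℝ) := by
    have : 0 < n := i.pos
    exact_mod_cast this
  have : totalSpin σ - (σ i : EuclideanSpace ℝ (Fin N)) =
      ∑ j ∈ Finset.univ.erase i, (σ j : EuclideanSpace ℝ (Fin N)) := by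
    rw [totalSpin, ← Finset.add_sum_erase _ _ (Finset.mem_univ i), add_sub_cancel_left]
  rw [locF, norm_smul, this, Real.norm_eq_abs, abs_of_pos (by positivity), one_div,
    inv_mul_le_iff₀ hn, mul_one]
  refine (norm_sum_le _ _).trans ?_
  simp only [sph_norm, Finset.sum_const, nsmul_eq_mul, mul_one]
  exact_mod_cast (Finset.card_le_univ _).trans (by simp)

lemma totalSpin_norm_le (σ : Fin n → UnitSphere N) : ‖totalSpin σ‖ ≤ n := by
  rw [totalSpin]
  refine (norm_sum_le _ _).trans ?_
  simp only [sph_norm, Finset.sum_const, nsmul_eq_mul, mul_one]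
  simp

lemma weight_update (β : ℝ) (σ : Fin n → UnitSphere N) (i : Fin n) (τ : UnitSphere N) :
    gibbsWeight N n β (Function.update σ i τ) =
      exp (β / (2 * n) * (‖totalSpin σ - (σ i : EuclideanSpace ℝ (Fin N))‖ ^ 2 + 1)) *
        exp (β * ⟪(τ : EuclideanSpace ℝ (Fin N)), locF σ i⟫) := by
  have hn : 0 < (n : ℝ) := by
    have : 0 < n := i.pos
    exact_mod_cast this
  rw [gibbsWeight_eq, totalSpin_update, ← exp_add, norm_add_sq_real, sph_norm, locF,
    inner_smul_right, real_inner_comm]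
  congr 1
  field_simp
  ring

/-- centered local observable -/
def obsX (N : ℕ) (μ : Measure (UnitSphere N)) (i0 : Fin N) (β : ℝ) (p : ℕ)
    (i : Fin n) (σ : Fin n → UnitSphere N) : ℝ :=
  ⟪(σ i : EuclideanSpace ℝ (Fin N)), locF σ i⟫ ^ p -
    ‖locF σ i‖ ^ p * tiltP N μ i0 p (β * ‖locF σ i‖)

lemma tiltP_continuous (i0 : Fin N) (p : ℕ) : Continuous (tiltP N μ i0 p) :=
  continuous_iff_continuousAt.2 fun x => (tiltP_hasDerivAt i0 p x).continuousAt

lemma locF_continuous (i : Fin n) :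
    Continuous (fun σ : Fin n → UnitSphere N => locF σ i) := by
  have := totalSpin_continuous (N := N) (n := n)
  unfold locF; fun_prop

lemma obsX_continuous (i0 : Fin N) (β : ℝ) (p : ℕ) (i : Fin n) :
    Continuous (obsX (n := n) N μ i0 β p i) := by
  have h1 := locF_continuous (N := N) i
  have h2 := tiltP_continuous (μ := μ) i0 p
  unfold obsX
  fun_prop

lemma obs_center
    (hμinv : ∀ e : EuclideanSpace ℝ (Fin N) ≃ₗᵢ[ℝ] EuclideanSpace ℝ (Fin N),
      Measure.map (sphereMap e) μ = μ) (i0 : Fin N) (β : ℝ) (p : ℕ) (i : Fin n)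
    (H : (Fin n → UnitSphere N) → ℝ) (hH : Continuous H)
    (hHu : ∀ σ τ, H (Function.update σ i τ) = H σ) :
    ∫ σ, obsX N μ i0 β p i σ * H σ ∂(gibbsMeasure N n β μ) = 0 := by
  have hc := gibbsWeight_continuous (N := N) (n := n) β
  have hX := obsX_continuous (μ := μ) i0 β p i
  rw [gibbs_integral, update_integral i _ (by fun_prop), div_eq_zero_iff]
  left
  rw [integral_eq_zero_of_ae]
  refine Filter.Eventually.of_forall fun σ => ?_
  simp only [weight_update, hHu, obsX, locF_update, Function.update_self, Pi.zero_apply]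
  set a := locF σ i
  set c := exp (β / (2 * n) * (‖totalSpin σ - (σ i : EuclideanSpace ℝ (Fin N))‖ ^ 2 + 1))
  have e : ∀ τ : UnitSphere N, c * exp (β * ⟪(τ : EuclideanSpace ℝ (Fin N)), a⟫) *
      ((⟪(τ : EuclideanSpace ℝ (Fin N)), a⟫ ^ p - ‖a‖ ^ p * tiltP N μ i0 p (β * ‖a‖)) * H σ) =
      (c * H σ) * (⟪(τ : EuclideanSpace ℝ (Fin N)), a⟫ ^ p *
        exp (β * ⟪(τ : EuclideanSpace ℝ (Fin N)), a⟫)) -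
      (c * H σ * (‖a‖ ^ p * tiltP N μ i0 p (β * ‖a‖))) *
       (⟪(τ : EuclideanSpace ℝ (Fin N)), a⟫ ^ 0 *
        exp (β * ⟪(τ : EuclideanSpace ℝ (Fin N)), a⟫)) := fun τ => by ring
  simp_rw [e]
  rw [integral_sub (aux_integrable μ (by fun_prop)) (aux_integrable μ (by fun_prop)),
    integral_const_mul, integral_const_mul, tilt_vec p hμinv i0, tilt_vec 0 hμinv i0, tiltP]
  have := (tiltM_zero_pos (μ := μ) i0 (β * ‖a‖)).ne'
  field_simp
  ring

lemma abs_pow_sub_le (p : ℕ) {a b : ℝ} (ha : |a| ≤ 1) (hb : |b| ≤ 1) :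
    |a ^ p - b ^ p| ≤ p * |a - b| := by
  induction p with
  | zero => simp
  | succ p ih =>
    have : a ^ (p + 1) - b ^ (p + 1) = a * (a ^ p - b ^ p) + (a - b) * b ^ p := by ring
    rw [this]
    refine (abs_add_le _ _).trans ?_
    rw [abs_mul, abs_mul, abs_pow]
    have h1 : |b| ^ p ≤ 1 := pow_le_one₀ (abs_nonneg _) hb
    have h2 := abs_nonneg (a - b)
    have h3 := abs_nonneg (a ^ p - b ^ p)
    push_cast
    nlinarith

lemma tiltQ_lip (i0 : Fin N) (β : ℝ) (hβ : 0 < β) (p : ℕ) {s t : ℝ} (hs : |s| ≤ 1) (ht : |t| ≤ 1) :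
    |s ^ p * tiltP N μ i0 p (β * s) - t ^ p * tiltP N μ i0 p (β * t)| ≤ (p + 2 * β) * |s - t| := by
  have : s ^ p * tiltP N μ i0 p (β * s) - t ^ p * tiltP N μ i0 p (β * t) =
    (s ^ p - t ^ p) * tiltP N μ i0 p (β * s) +
      t ^ p * (tiltP N μ i0 p (β * s) - tiltP N μ i0 p (β * t)) := by ring
  rw [this]
  refine (abs_add_le _ _).trans ?_
  rw [abs_mul, abs_mul, abs_pow t]
  have h1 := abs_pow_sub_le p hs ht
  have h2 := tiltP_lip (μ := μ) i0 p (β * s) (β * t)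
  rw [← mul_sub, abs_mul, abs_of_pos hβ] at h2
  have h3 : |t| ^ p ≤ 1 := pow_le_one₀ (abs_nonneg _) ht
  have h4 := tiltP_abs_le (μ := μ) i0 p (β * s)
  have h5 := abs_nonneg (s ^ p - t ^ p)
  have h6 := abs_nonneg (tiltP N μ i0 p (β * s) - tiltP N μ i0 p (β * t))
  have h7 : 0 ≤ |t| ^ p := by positivity
  nlinarith

lemma abs_inner_sph_le (τ : UnitSphere N) (a : EuclideanSpace ℝ (Fin N)) :
    |⟪(τ : EuclideanSpace ℝ (Fin N)), a⟫| ≤ ‖a‖ := by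
  have := abs_real_inner_le_norm (τ : EuclideanSpace ℝ (Fin N)) a
  rwa [sph_norm, one_mul] at this

lemma obsX_abs_le (i0 : Fin N) (β : ℝ) (p : ℕ) (i : Fin n) (σ : Fin n → UnitSphere N) :
    |obsX N μ i0 β p i σ| ≤ 2 := by
  unfold obsX
  refine (abs_sub _ _).trans ?_
  have h1 : |⟪(σ i : EuclideanSpace ℝ (Fin N)), locF σ i⟫ ^ p| ≤ 1 := by
    rw [abs_pow]
    exact pow_le_one₀ (abs_nonneg _) ((abs_inner_sph_le _ _).trans (locF_norm_le _ _))
  have h2 : |‖locF σ i‖ ^ p * tiltP N μ i0 p (β * ‖locF σ i‖)| ≤ 1 := by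
    rw [abs_mul]
    have := tiltP_abs_le (μ := μ) i0 p (β * ‖locF σ i‖)
    refine mul_le_one₀ ?_ (abs_nonneg _) this
    rw [abs_of_nonneg (by positivity)]
    exact pow_le_one₀ (norm_nonneg _) (locF_norm_le _ _)
  linarith

lemma obsX_update (i0 : Fin N) (β : ℝ) (hβ : 0 < β) (p : ℕ) (i j : Fin n) (hij : i ≠ j)
    (σ : Fin n → UnitSphere N) (τ : UnitSphere N) :
    |obsX N μ i0 β p j σ - obsX N μ i0 β p j (Function.update σ i τ)| ≤
      (4 * p + 4 * β) / n := by
  have hn : 0 < (n : ℝ) := by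
    have : 0 < n := i.pos
    exact_mod_cast this
  have hd : locF σ j - locF (Function.update σ i τ) j =
      (1 / (n : ℝ)) • ((σ i : EuclideanSpace ℝ (Fin N)) - τ) := by
    simp only [locF, totalSpin_update, Function.update_of_ne hij.symm]
    rw [← smul_sub]; congr 1; abel
  have hdn : ‖locF σ j - locF (Function.update σ i τ) j‖ ≤ 2 / n := by
    rw [hd, norm_smul, Real.norm_eq_abs, abs_of_pos (by positivity)]
    have : ‖(σ i : EuclideanSpace ℝ (Fin N)) - τ‖ ≤ 2 := by
      refine (norm_sub_le _ _).trans ?_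
      rw [sph_norm, sph_norm]; norm_num
    calc 1 / (n : ℝ) * ‖(σ i : EuclideanSpace ℝ (Fin N)) - τ‖ ≤ 1 / n * 2 := by gcongr
      _ = 2 / n := by ring
  simp only [obsX, Function.update_of_ne hij.symm]
  set a := locF σ j
  set a' := locF (Function.update σ i τ) j
  have ha : ‖a‖ ≤ 1 := locF_norm_le _ _
  have ha' : ‖a'‖ ≤ 1 := locF_norm_le _ _
  have h1 := abs_pow_sub_le p ((abs_inner_sph_le (σ j) a).trans ha)
    ((abs_inner_sph_le (σ j) a').trans ha')
  have h2 : |⟪(σ j : EuclideanSpace ℝ (Fin N)), a⟫ - ⟪(σ j : EuclideanSpace ℝ (Fin N)), a'⟫| ≤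
      2 / n := by
    rw [← inner_sub_right]
    exact (abs_inner_sph_le _ _).trans hdn
  have h3 := tiltQ_lip (μ := μ) i0 β hβ p (s := ‖a‖) (t := ‖a'‖) (by rwa [abs_norm])
    (by rwa [abs_norm])
  have h4 : |‖a‖ - ‖a'‖| ≤ 2 / n := (abs_norm_sub_norm_le _ _).trans hdn
  have e : ∀ x y z w : ℝ, x - y - (z - w) = (x - z) - (y - w) := fun x y z w => by ring
  rw [e]
  refine (abs_sub _ _).trans ?_
  have h5 : (p : ℝ) * |⟪(σ j : EuclideanSpace ℝ (Fin N)), a⟫ -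
      ⟪(σ j : EuclideanSpace ℝ (Fin N)), a'⟫| ≤ p * (2 / n) := by gcongr
  have h6 : (p + 2 * β) * |‖a‖ - ‖a'‖| ≤ (p + 2 * β) * (2 / n) := by gcongr
  have h7 : (4 * p + 4 * β) / n = p * (2 / n) + (p + 2 * β) * (2 / n) := by ring
  linarith

lemma obs_var (hN : 2 ≤ N)
    (hμinv : ∀ e : EuclideanSpace ℝ (Fin N) ≃ₗᵢ[ℝ] EuclideanSpace ℝ (Fin N),
      Measure.map (sphereMap e) μ = μ) (i0 : Fin N) (β : ℝ) (hβ : 0 < β) (p : ℕ) (hn : 1 ≤ n) :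
    ∫ σ, |1 / (n : ℝ) * ∑ i, obsX N μ i0 β p i σ| ∂(gibbsMeasure N n β μ) ≤
      (5 + 8 * p + 8 * β) / √n := by
  have hn' : 0 < (n : ℝ) := by exact_mod_cast hn
  set G := gibbsMeasure N n β μ
  have hX := fun i : Fin n => obsX_continuous (μ := μ) (n := n) i0 β p i
  let e0 : UnitSphere N := ⟨EuclideanSpace.single i0 1, by simp⟩
  have hcov : ∀ i j : Fin n, ∫ σ, obsX N μ i0 β p i σ * obsX N μ i0 β p j σ ∂G ≤
      (if i = j then 4 else 0) + 2 * ((4 * p + 4 * β) / n) := by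
    intro i j
    have hK : 0 ≤ 2 * ((4 * p + 4 * β) / n) := by positivity
    by_cases hij : i = j
    · subst hij
      simp only [if_true]
      have : ∫ σ, obsX N μ i0 β p i σ * obsX N μ i0 β p i σ ∂G ≤ ∫ σ, (4:ℝ) ∂G := by
        refine integral_mono (aux_integrable G ((hX i).mul (hX i))) (integrable_const _) ?_
        intro σ
        have := obsX_abs_le (μ := μ) i0 β p i σ
        have h2 := abs_le.1 this
        simp only
        nlinarith
      simp at this
      linarith
    · simp only [if_neg hij, zero_add]
      have hu : Continuous fun σ : Fin n → UnitSphere N => Function.update σ i e0 :=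
        continuous_id.update i continuous_const
      have hz := obs_center hμinv i0 β p i
        (fun σ => obsX N μ i0 β p j (Function.update σ i e0)) ((hX j).comp hu)
        (fun σ τ => by simp)
      have hs : ∫ σ, obsX N μ i0 β p i σ * obsX N μ i0 β p j σ ∂G =
          ∫ σ, obsX N μ i0 β p i σ * (obsX N μ i0 β p j σ -
            obsX N μ i0 β p j (Function.update σ i e0)) ∂G := by
        simp only [mul_sub]
        have h1 := hX i
        have h2 := hX j
        have h3 : Continuous fun σ => obsX N μ i0 β p j (Function.update σ i e0) := h2.comp hu
        rw [integral_sub (aux_integrable G (by fun_prop))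
          (aux_integrable G (by fun_prop)), hz, sub_zero]
      rw [hs]
      have : ∫ σ, obsX N μ i0 β p i σ * (obsX N μ i0 β p j σ -
            obsX N μ i0 β p j (Function.update σ i e0)) ∂G ≤
          ∫ σ, 2 * ((4 * p + 4 * β) / n) ∂G := by
        refine integral_mono (aux_integrable G ((hX i).mul ((hX j).sub ((hX j).comp hu))))
          (integrable_const _) ?_
        intro σ
        simp only
        refine (le_abs_self _).trans ?_
        rw [abs_mul]
        exact mul_le_mul (obsX_abs_le i0 β p i σ) (obsX_update i0 β hβ p i j hij σ e0)
          (abs_nonneg _) (by norm_num)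
      simpa using this
  have hsq : ∫ σ, (1 / (n : ℝ) * ∑ i, obsX N μ i0 β p i σ) ^ 2 ∂G ≤ (4 + 8 * p + 8 * β) / n := by
    have e : ∀ σ : Fin n → UnitSphere N, (1 / (n : ℝ) * ∑ i, obsX N μ i0 β p i σ) ^ 2 =
        1 / (n : ℝ) ^ 2 * ∑ i, ∑ j, obsX N μ i0 β p i σ * obsX N μ i0 β p j σ := fun σ => by
      rw [mul_pow, pow_two (∑ i, _), Finset.sum_mul_sum]; ring
    simp_rw [e]
    rw [integral_const_mul, integral_finsetSum _ (fun i _ => aux_integrable G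
      (show Continuous (fun σ => ∑ j, obsX N μ i0 β p i σ * obsX N μ i0 β p j σ) from
        continuous_finsetSum _ fun j _ => (hX i).mul (hX j)))]
    have : ∑ i, ∫ σ, ∑ j, obsX N μ i0 β p i σ * obsX N μ i0 β p j σ ∂G ≤
        ∑ i : Fin n, ∑ j : Fin n, ((if i = j then 4 else 0) + 2 * ((4 * p + 4 * β) / n)) := by
      refine Finset.sum_le_sum fun i _ => ?_
      rw [integral_finsetSum _ (fun j _ => aux_integrable G
        (show Continuous (fun σ => obsX N μ i0 β p i σ * obsX N μ i0 β p j σ) from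
          (hX i).mul (hX j)))]
      exact Finset.sum_le_sum fun j _ => hcov i j
    have h2 : ∑ i : Fin n, ∑ j : Fin n, ((if i = j then (4:ℝ) else 0) + 2 * ((4 * p + 4 * β) / n))
        = n * (4 + 8 * p + 8 * β) := by
      simp only [Finset.sum_add_distrib, Finset.sum_ite_eq, Finset.mem_univ, if_true,
        Finset.sum_const, Finset.card_univ, Fintype.card_fin, nsmul_eq_mul]
      field_simp
      ring
    rw [h2] at this
    calc _ ≤ 1 / (n : ℝ) ^ 2 * (n * (4 + 8 * p + 8 * β)) := by gcongr
      _ = _ := by field_simp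
  have hsc : Continuous fun σ : Fin n → UnitSphere N => 1 / (n : ℝ) * ∑ i, obsX N μ i0 β p i σ :=
    continuous_const.mul (continuous_finsetSum _ fun i _ => hX i)
  have hsn : 0 < √(n : ℝ) := sqrt_pos.2 hn'
  have hss : √(n : ℝ) * √n = n := mul_self_sqrt hn'.le
  calc ∫ σ, |1 / (n : ℝ) * ∑ i, obsX N μ i0 β p i σ| ∂G
      ≤ ∫ σ, (√n * (1 / (n : ℝ) * ∑ i, obsX N μ i0 β p i σ) ^ 2 + 1 / √n) ∂G := by
        refine integral_mono (aux_integrable G hsc.abs)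
          ((aux_integrable G (hsc.pow 2)).const_mul _ |>.add (integrable_const _)) ?_
        intro σ
        simp only
        set a := 1 / (n : ℝ) * ∑ i, obsX N μ i0 β p i σ
        rw [← sq_abs a]
        have h1 : 0 ≤ |a| := abs_nonneg a
        have h2 : √n * |a| ^ 2 + 1 / √n - |a| = (1 / √n) * (√n ^ 2 * |a| ^ 2 + 1 - √n * |a|) := by
          field_simp
        have h3 : 0 ≤ √n ^ 2 * |a| ^ 2 + 1 - √n * |a| := by nlinarith [sq_nonneg (√n * |a| - 1)]
        have h4 : 0 ≤ (1 / √n) * (√n ^ 2 * |a| ^ 2 + 1 - √n * |a|) := by positivity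
        linarith
    _ = √n * ∫ σ, (1 / (n : ℝ) * ∑ i, obsX N μ i0 β p i σ) ^ 2 ∂G + 1 / √n := by
        rw [integral_add (aux_integrable G (by fun_prop)) (integrable_const _),
          integral_const_mul]
        simp
    _ ≤ √n * ((4 + 8 * p + 8 * β) / n) + 1 / √n := by gcongr
    _ = (5 + 8 * p + 8 * β) / √n := by
        have h1 : √(n:ℝ) / n = 1 / √n := by
          rw [div_eq_div_iff hn'.ne' hsn.ne', hss, one_mul]
        have h2 : √n * ((4 + 8 * p + 8 * β) / n) = (4 + 8 * p + 8 * β) * (√(n:ℝ) / n) := by ring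
        rw [h2, h1]; ring

end gibbs

section gibbs
variable {N n : ℕ} {μ : Measure (UnitSphere N)} [IsProbabilityMeasure μ]

lemma cosh_lower (x : ℝ) : 1 + x ^ 2 / 2 ≤ cosh x := by
  have h : cosh x = 1 + 2 * sinh (x / 2) ^ 2 := by
    have h1 := cosh_two_mul (x / 2)
    have h2 := cosh_sq (x / 2)
    rw [show 2 * (x / 2) = x by ring] at h1
    linarith
  have h2 : (x / 2) ^ 2 ≤ sinh (x / 2) ^ 2 := by
    rw [sq_le_sq, abs_sinh]
    exact self_le_sinh_iff.2 (abs_nonneg _)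
  rw [h]; nlinarith

lemma tiltM_lower (hN : 2 ≤ N)
    (hμinv : ∀ e : EuclideanSpace ℝ (Fin N) ≃ₗᵢ[ℝ] EuclideanSpace ℝ (Fin N),
      Measure.map (sphereMap e) μ = μ) (i : Fin N) (x : ℝ) :
    1 + x ^ 2 / (2 * N) ≤ tiltM N μ i 0 x := by
  have hN' : (2 : ℝ) ≤ N := by exact_mod_cast hN
  have hco : Continuous (fun τ : UnitSphere N => τ.1 i) := by fun_prop
  have h2 : ∫ τ : UnitSphere N, τ.1 i ^ 2 ∂μ = 1 / N := by
    have := integral_parts hμinv (fun u => u) (fun _ => 1) (fun u => hasDerivAt_id u)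
      continuous_const i
    simp only [one_mul] at this
    rw [integral_sub (integrable_const _) (aux_integrable μ (by fun_prop))] at this
    simp only [← pow_two] at this
    simp at this
    field_simp
    linarith
  have hsym : ∫ τ : UnitSphere N, exp (x * τ.1 i) ∂μ = ∫ τ : UnitSphere N, exp (-(x * τ.1 i)) ∂μ := by
    have := integral_unit hμinv (EuclideanSpace.single i (1:ℝ)) (-EuclideanSpace.single i (1:ℝ))
      (by simp) (fun u => exp (x * u)) (by fun_prop)
    simpa only [inner_neg_right, sphere_coord_eq, mul_neg] using this
  have h0 : tiltM N μ i 0 x = ∫ τ : UnitSphere N, cosh (x * τ.1 i) ∂μ := by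
    simp only [tiltM, pow_zero, one_mul, cosh_eq]
    rw [integral_div, integral_add (aux_integrable μ (by fun_prop)) (aux_integrable μ (by fun_prop)),
      ← hsym]
    ring
  rw [h0]
  have h3 : ∫ τ : UnitSphere N, (1 + x ^ 2 / 2 * τ.1 i ^ 2) ∂μ = 1 + x ^ 2 / (2 * N) := by
    rw [integral_add (integrable_const _) (aux_integrable μ (by fun_prop)), integral_const_mul, h2]
    simp
    field_simp
  rw [← h3]
  refine integral_mono (aux_integrable μ (by fun_prop)) (aux_integrable μ (by fun_prop)) fun τ => ?_
  simp only
  have := cosh_lower (x * τ.1 i)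
  nlinarith

lemma exists_rho (hN : 2 ≤ N)
    (hμinv : ∀ e : EuclideanSpace ℝ (Fin N) ≃ₗᵢ[ℝ] EuclideanSpace ℝ (Fin N),
      Measure.map (sphereMap e) μ = μ) (i0 : Fin N) (β : ℝ) (hβ : (N : ℝ) < β) :
    ∃ ρ > 1, ∀ n : ℕ, 1 ≤ n → ρ ^ n ≤ gibbsZ N n β μ := by
  have hN' : (2 : ℝ) ≤ N := by exact_mod_cast hN
  have hβ0 : 0 < β := by linarith
  set k := β / N - 1 with hk
  have hkpos : 0 < k := by
    rw [hk, sub_pos, lt_div_iff₀ (by linarith)]; linarith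
  set y := min (k / 2) 1 with hy
  have hypos : 0 < y := lt_min (by positivity) one_pos
  set s := √(2 * y / β) with hs
  have hs2 : s ^ 2 = 2 * y / β := sq_sqrt (by positivity)
  have hexp : exp (β * s ^ 2 / 2) < tiltM N μ i0 0 (β * s) := by
    have h1 := tiltM_lower hN hμinv i0 (β * s)
    have h2 : (β * s) ^ 2 / (2 * N) = (1 + k) * y := by
      rw [mul_pow, hs2, hk]; field_simp; ring
    have h3 : β * s ^ 2 / 2 = y := by rw [hs2]; field_simp
    have h4 := abs_exp_sub_one_sub_id_le (x := y) (by rw [abs_of_pos hypos]; exact min_le_right _ _)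
    have h5 := (abs_le.1 h4).2
    have h6 : y ≤ k / 2 := min_le_left _ _
    rw [h3]; rw [h2] at h1
    nlinarith
  refine ⟨tiltM N μ i0 0 (β * s) / exp (β * s ^ 2 / 2), (one_lt_div (exp_pos _)).2 hexp, ?_⟩
  intro n hn
  have hn' : 0 < (n : ℝ) := by exact_mod_cast hn
  have hco : Continuous (fun τ : UnitSphere N => τ.1 i0) := by fun_prop
  have e : (tiltM N μ i0 0 (β * s) / exp (β * s ^ 2 / 2)) ^ n =
      ∫ σ : Fin n → UnitSphere N, ∏ j, (exp (β * s * (σ j).1 i0) / exp (β * s ^ 2 / 2))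
        ∂(Measure.pi fun _ : Fin n => μ) := by
    rw [integral_fintype_prod_eq_pow (fun τ : UnitSphere N =>
      exp (β * s * τ.1 i0) / exp (β * s ^ 2 / 2)), integral_div, Fintype.card_fin]
    simp [tiltM]
  rw [e, gibbsZ]
  have hw := gibbsWeight_continuous (N := N) (n := n) β
  refine integral_mono (aux_integrable _ (by fun_prop)) (aux_integrable _ hw) fun σ => ?_
  simp only [← exp_sub]
  rw [← exp_sum, gibbsWeight_eq]
  apply exp_le_exp.2
  rw [Finset.sum_sub_distrib, ← Finset.mul_sum]
  simp only [Finset.sum_const, Finset.card_univ, Fintype.card_fin, nsmul_eq_mul]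
  have h1 : ∑ j, (σ j).1 i0 = ⟪totalSpin σ, EuclideanSpace.single i0 (1:ℝ)⟫ := by
    rw [totalSpin, sum_inner]
    exact Finset.sum_congr rfl fun j _ => (sphere_coord_eq _ _).symm
  have h2 : 0 ≤ ‖totalSpin σ - (n * s) • EuclideanSpace.single i0 (1:ℝ)‖ ^ 2 := by positivity
  rw [norm_sub_sq_real, inner_smul_right, ← h1, norm_smul] at h2
  simp at h2
  rw [abs_of_nonneg (sqrt_nonneg _)] at h2
  set A := ∑ j, (σ j).1 i0
  have h3 : β / (2 * n) * ‖totalSpin σ‖ ^ 2 - (β * s * A - n * (β * s ^ 2 / 2)) =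
    β / (2 * n) * (‖totalSpin σ‖ ^ 2 - 2 * (n * s * A) + (n * s) ^ 2) := by
    field_simp
    ring
  have h4 : 0 ≤ β / (2 * n) * (‖totalSpin σ‖ ^ 2 - 2 * (n * s * A) + (n * s) ^ 2) :=
    mul_nonneg (by positivity) h2
  linarith

lemma small_prob (hN : 2 ≤ N)
    (hμinv : ∀ e : EuclideanSpace ℝ (Fin N) ≃ₗᵢ[ℝ] EuclideanSpace ℝ (Fin N),
      Measure.map (sphereMap e) μ = μ) (i0 : Fin N) (β : ℝ) (hβ : (N : ℝ) < β) :
    ∃ δ > 0, ∃ h > 0, ∀ n : ℕ, 1 ≤ n →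
      ∫ σ : Fin n → UnitSphere N, ({σ : Fin n → UnitSphere N | ‖totalSpin σ‖ / n < δ}).indicator
        (fun _ => (1 : ℝ)) σ ∂(gibbsMeasure N n β μ) ≤ 1 / (h * n) := by
  have hN' : (2 : ℝ) ≤ N := by exact_mod_cast hN
  have hβ0 : 0 < β := by linarith
  obtain ⟨ρ, hρ, hZ⟩ := exists_rho hN hμinv i0 β hβ
  have hρ0 : 0 < ρ := by linarith
  have hsr : 1 < √ρ := by rw [lt_sqrt (by norm_num)]; simpa using hρ
  have hlog : 0 < log (√ρ) := log_pos hsr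
  refine ⟨√(2 * log √ρ / β), by positivity, √ρ - 1, by linarith, fun n hn => ?_⟩
  set δ := √(2 * log √ρ / β) with hδ
  have hδ2 : δ ^ 2 = 2 * log √ρ / β := sq_sqrt (by positivity)
  have hn' : 0 < (n : ℝ) := by exact_mod_cast hn
  have hsp := totalSpin_continuous (N := N) (n := n)
  set S := {σ : Fin n → UnitSphere N | ‖totalSpin σ‖ / n < δ} with hS
  have hZpos := gibbsZ_pos (N := N) (n := n) (μ := μ) β
  rw [gibbs_integral]
  have hb : ∫ σ, gibbsWeight N n β σ * S.indicator (fun _ => (1:ℝ)) σ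
      ∂(Measure.pi fun _ : Fin n => μ) ≤ (√ρ) ^ n := by
    have : ∫ σ, gibbsWeight N n β σ * S.indicator (fun _ => (1:ℝ)) σ
      ∂(Measure.pi fun _ : Fin n => μ) ≤ ∫ σ, (√ρ) ^ n ∂(Measure.pi fun _ : Fin n => μ) := by
      refine integral_mono_of_nonneg (Filter.Eventually.of_forall fun σ => ?_)
        (integrable_const _) (Filter.Eventually.of_forall fun σ => ?_)
      · exact mul_nonneg (gibbsWeight_pos β σ).le (Set.indicator_nonneg (fun _ _ => by norm_num) _)
      · simp only
        by_cases hσ : σ ∈ S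
        · rw [Set.indicator_of_mem hσ, mul_one, gibbsWeight_eq]
          have h1 : ‖totalSpin σ‖ / n < δ := hσ
          have h2 : ‖totalSpin σ‖ ≤ δ * n := ((div_lt_iff₀ hn').1 h1).le
          have h3 : ‖totalSpin σ‖ ^ 2 ≤ (δ * n) ^ 2 := by gcongr
          have h4 : (√ρ) ^ n = exp (n * log √ρ) := by
            rw [exp_nat_mul, exp_log (by positivity)]
          rw [h4]
          apply exp_le_exp.2
          calc β / (2 * n) * ‖totalSpin σ‖ ^ 2 ≤ β / (2 * n) * (δ * n) ^ 2 := by gcongr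
            _ = n * log √ρ := by rw [mul_pow, hδ2]; field_simp
        · rw [Set.indicator_of_notMem hσ, mul_zero]; positivity
    simpa using this
  have hbern := one_add_mul_le_pow (a := √ρ - 1) (by linarith) n
  rw [add_sub_cancel] at hbern
  have hp : 0 < (√ρ) ^ n := by positivity
  have hZ' : (√ρ) ^ n * (√ρ) ^ n ≤ gibbsZ N n β μ := by
    rw [← mul_pow, mul_self_sqrt hρ0.le]; exact hZ n hn
  rw [div_le_div_iff₀ hZpos (mul_pos (by linarith) hn'), one_mul]
  calc _ ≤ (√ρ) ^ n * ((√ρ - 1) * n) := by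
        refine mul_le_mul_of_nonneg_right hb (mul_nonneg (by linarith) hn'.le)
    _ ≤ (√ρ) ^ n * (√ρ) ^ n := by
        refine mul_le_mul_of_nonneg_left ?_ hp.le
        linarith
    _ ≤ _ := hZ'

end gibbs

section final
variable {N n : ℕ} {μ : Measure (UnitSphere N)} [IsProbabilityMeasure μ]

/-- conditional second moment of the local observable -/
def locV (N : ℕ) (μ : Measure (UnitSphere N)) (i0 : Fin N) (β : ℝ)
    (i : Fin n) (σ : Fin n → UnitSphere N) : ℝ :=
  ⟪(σ i : EuclideanSpace ℝ (Fin N)), locF σ i⟫ ^ 2 -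
    2 * ⟪(σ i : EuclideanSpace ℝ (Fin N)), locF σ i⟫ *
      (‖locF σ i‖ ^ 1 * tiltP N μ i0 1 (β * ‖locF σ i‖)) +
    ‖locF σ i‖ ^ 2 * tiltP N μ i0 2 (β * ‖locF σ i‖)

lemma W_diff (β b : ℝ) (hb : 0 < b) (σ : Fin n → UnitSphere N) (i : Fin n) (τ : UnitSphere N) :
    (Wspin N n β b σ - Wspin N n β b (Function.update σ i τ)) ^ 2 =
      4 * β ^ 4 / (n * b ^ 4) * (⟪(σ i : EuclideanSpace ℝ (Fin N)), locF σ i⟫ -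
        ⟪(τ : EuclideanSpace ℝ (Fin N)), locF σ i⟫) ^ 2 := by
  have hn : 0 < (n : ℝ) := by
    have : 0 < n := i.pos
    exact_mod_cast this
  set R := totalSpin σ - (σ i : EuclideanSpace ℝ (Fin N)) with hR
  have h1 : totalSpin σ = R + (σ i : EuclideanSpace ℝ (Fin N)) := by simp [hR]
  simp only [Wspin, totalSpin_update, locF]
  rw [← hR, h1, norm_add_sq_real, norm_add_sq_real, sph_norm, sph_norm, inner_smul_right,
    inner_smul_right, real_inner_comm R, real_inner_comm R]
  set x := ⟪R, (σ i : EuclideanSpace ℝ (Fin N))⟫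
  set y := ⟪R, (τ : EuclideanSpace ℝ (Fin N))⟫
  have e : √(n : ℝ) * (β ^ 2 / ((n : ℝ) ^ 2 * b ^ 2) * (‖R‖ ^ 2 + 2 * x + 1 ^ 2) - 1) -
      √(n : ℝ) * (β ^ 2 / ((n : ℝ) ^ 2 * b ^ 2) * (‖R‖ ^ 2 + 2 * y + 1 ^ 2) - 1) =
      √(n : ℝ) * (β ^ 2 / ((n : ℝ) ^ 2 * b ^ 2) * (2 * (x - y))) := by ring
  rw [e, mul_pow, sq_sqrt hn.le]
  field_simp
  ring

lemma D2_eq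
    (hμinv : ∀ e : EuclideanSpace ℝ (Fin N) ≃ₗᵢ[ℝ] EuclideanSpace ℝ (Fin N),
      Measure.map (sphereMap e) μ = μ) (i0 : Fin N) (β b : ℝ) (hb : 0 < b)
    (σ : Fin n → UnitSphere N) :
    D2 N n β b μ σ = 4 * β ^ 4 / (n * b ^ 4) * (1 / (n : ℝ) * ∑ i, locV N μ i0 β i σ) := by
  rw [D2, mul_left_comm (4 * β ^ 4 / (n * b ^ 4))]
  congr 1
  rw [Finset.mul_sum]
  refine Finset.sum_congr rfl fun i _ => ?_
  have hn : 0 < (n : ℝ) := by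
    have : 0 < n := i.pos
    exact_mod_cast this
  have hin : ∀ τ : UnitSphere N, β / n * ⟪(τ : EuclideanSpace ℝ (Fin N)),
      totalSpin σ - (σ i : EuclideanSpace ℝ (Fin N))⟫ =
      β * ⟪(τ : EuclideanSpace ℝ (Fin N)), locF σ i⟫ := fun τ => by
    rw [locF, inner_smul_right]; ring
  simp only [W_diff β b hb, condDens, hin]
  set a := locF σ i with ha
  set Y := ⟪(σ i : EuclideanSpace ℝ (Fin N)), a⟫ with hY
  have hZ : ∫ τ : UnitSphere N, exp (β * ⟪(τ : EuclideanSpace ℝ (Fin N)), a⟫) ∂μ =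
      tiltM N μ i0 0 (β * ‖a‖) := by
    simpa using tilt_vec 0 hμinv i0 a β
  rw [hZ]
  have hpos := tiltM_zero_pos (μ := μ) i0 (β * ‖a‖)
  set Z := tiltM N μ i0 0 (β * ‖a‖) with hZd
  have e : ∀ τ : UnitSphere N, 4 * β ^ 4 / (n * b ^ 4) *
      (Y - ⟪(τ : EuclideanSpace ℝ (Fin N)), a⟫) ^ 2 *
        (exp (β * ⟪(τ : EuclideanSpace ℝ (Fin N)), a⟫) / Z) =
      4 * β ^ 4 / (n * b ^ 4) / Z * (Y ^ 2 * (⟪(τ : EuclideanSpace ℝ (Fin N)), a⟫ ^ 0 *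
        exp (β * ⟪(τ : EuclideanSpace ℝ (Fin N)), a⟫)) -
        2 * Y * (⟪(τ : EuclideanSpace ℝ (Fin N)), a⟫ ^ 1 *
        exp (β * ⟪(τ : EuclideanSpace ℝ (Fin N)), a⟫)) +
        (⟪(τ : EuclideanSpace ℝ (Fin N)), a⟫ ^ 2 *
        exp (β * ⟪(τ : EuclideanSpace ℝ (Fin N)), a⟫))) := fun τ => by ring
  simp_rw [e]
  rw [integral_const_mul, integral_add (aux_integrable μ (by fun_prop))
    (aux_integrable μ (by fun_prop)), integral_sub (aux_integrable μ (by fun_prop))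
    (aux_integrable μ (by fun_prop)), integral_const_mul, integral_const_mul,
    tilt_vec 0 hμinv i0, tilt_vec 1 hμinv i0, tilt_vec 2 hμinv i0, locV, ← ha, ← hY, tiltP, tiltP,
    ← hZd]
  field_simp

lemma avg_Y (hn : 1 ≤ n) (σ : Fin n → UnitSphere N) :
    1 / (n : ℝ) * ∑ i, ⟪(σ i : EuclideanSpace ℝ (Fin N)), locF σ i⟫ =
      (‖totalSpin σ‖ / n) ^ 2 - 1 / n := by
  have hn' : 0 < (n : ℝ) := by exact_mod_cast hn
  have h : ∀ i, ⟪(σ i : EuclideanSpace ℝ (Fin N)), locF σ i⟫ =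
      1 / (n : ℝ) * ⟪(σ i : EuclideanSpace ℝ (Fin N)), totalSpin σ⟫ - 1 / n := fun i => by
    rw [locF, inner_smul_right, inner_sub_right, real_inner_self_eq_norm_sq, sph_norm]; ring
  simp only [h]
  rw [Finset.sum_sub_distrib, ← Finset.mul_sum, ← sum_inner]
  change 1 / (n : ℝ) * (1 / (n : ℝ) * ⟪totalSpin σ, totalSpin σ⟫ - _) = _
  rw [real_inner_self_eq_norm_sq]
  simp only [Finset.sum_const, Finset.card_univ, Fintype.card_fin, nsmul_eq_mul]
  field_simp

lemma locF_close (σ : Fin n → UnitSphere N) (i : Fin n) :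
    |‖locF σ i‖ - ‖totalSpin σ‖ / n| ≤ 1 / n := by
  have hn : 0 < (n : ℝ) := by
    have : 0 < n := i.pos
    exact_mod_cast this
  have h1 : ‖totalSpin σ‖ / n = ‖(1 / (n : ℝ)) • totalSpin σ‖ := by
    rw [norm_smul, Real.norm_eq_abs, abs_of_pos (by positivity)]; ring
  rw [h1]
  refine (abs_norm_sub_norm_le _ _).trans ?_
  rw [locF, ← smul_sub, norm_smul, Real.norm_eq_abs, abs_of_pos (by positivity), sub_sub_cancel_left,
    norm_neg, sph_norm, mul_one]

lemma avg_le (hn : 1 ≤ n) (F : Fin n → ℝ) (K : ℝ) (h : ∀ i, |F i| ≤ K) :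
    |1 / (n : ℝ) * ∑ i, F i| ≤ K := by
  have hn' : 0 < (n : ℝ) := by exact_mod_cast hn
  rw [abs_mul, abs_of_pos (by positivity), one_div, inv_mul_le_iff₀ hn']
  refine (Finset.abs_sum_le_sum_abs _ _).trans ?_
  refine (Finset.sum_le_sum fun i _ => h i).trans ?_
  simp

lemma mag_norm (hn : 1 ≤ n) (σ : Fin n → UnitSphere N) : |‖totalSpin σ‖ / n| ≤ 1 := by
  have hn' : 0 < (n : ℝ) := by exact_mod_cast hn
  rw [abs_of_nonneg (by positivity), div_le_one hn']
  exact totalSpin_norm_le σ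

lemma point_V (hn : 1 ≤ n) (i0 : Fin N) (β : ℝ) (hβ : 0 < β) (r : ℝ) (hr : |r| ≤ 1)
    (hr1 : r ^ 1 * tiltP N μ i0 1 (β * r) = r ^ 2) (σ : Fin n → UnitSphere N) :
    |1 / (n : ℝ) * ∑ i, locV N μ i0 β i σ - (2 * (r ^ 2 * tiltP N μ i0 2 (β * r)) - 2 * r ^ 4)| ≤
      |1 / (n : ℝ) * ∑ i, obsX N μ i0 β 2 i σ| +
        (10 + 8 * β) * (|‖totalSpin σ‖ / n - r| + 1 / n) := by
  have hn' : 0 < (n : ℝ) := by exact_mod_cast hn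
  set t := ‖totalSpin σ‖ / n with ht
  have ht1 : |t| ≤ 1 := mag_norm hn σ
  set q := r ^ 2 * tiltP N μ i0 2 (β * r) with hq
  let Y : Fin n → ℝ := fun i => ⟪(σ i : EuclideanSpace ℝ (Fin N)), locF σ i⟫
  let s : Fin n → ℝ := fun i => ‖locF σ i‖
  let F : Fin n → ℝ := fun i => 2 * (s i ^ 2 * tiltP N μ i0 2 (β * s i) - q) -
    2 * Y i * (s i ^ 1 * tiltP N μ i0 1 (β * s i) - r ^ 2)
  have e0 : ∑ i, locV N μ i0 β i σ =
      ∑ i, obsX N μ i0 β 2 i σ + ∑ i, F i - 2 * r ^ 2 * ∑ i, Y i + n * (2 * q) := by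
    have h0 : (n : ℝ) * (2 * q) = ∑ _i : Fin n, 2 * q := by simp
    rw [h0, Finset.mul_sum]
    simp only [← Finset.sum_sub_distrib, ← Finset.sum_add_distrib]
    refine Finset.sum_congr rfl fun i _ => ?_
    simp only [F, locV, obsX, Y, s]
    ring
  have e : 1 / (n : ℝ) * ∑ i, locV N μ i0 β i σ - (2 * q - 2 * r ^ 4) =
      1 / (n : ℝ) * ∑ i, obsX N μ i0 β 2 i σ + 1 / (n : ℝ) * ∑ i, F i -
        2 * r ^ 2 * (1 / (n : ℝ) * ∑ i, Y i - r ^ 2) := by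
    rw [e0]
    field_simp
    ring
  rw [e]
  have hF : ∀ i, |F i| ≤ (6 + 8 * β) * (|t - r| + 1 / n) := fun i => by
    have hs : |s i| ≤ 1 := by
      simp only [s, abs_norm]; exact locF_norm_le σ i
    have hY : |Y i| ≤ 1 := (abs_inner_sph_le _ _).trans (locF_norm_le σ i)
    have h1 := tiltQ_lip (μ := μ) i0 β hβ 2 hs hr
    have h2 := tiltQ_lip (μ := μ) i0 β hβ 1 hs hr
    rw [← hq] at h1
    rw [hr1] at h2
    have h3 : |s i - r| ≤ |t - r| + 1 / n := by
      have := locF_close σ i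
      have h4 := abs_sub_le (s i) t r
      simp only [s] at h4 ⊢
      linarith
    simp only [F]
    refine (abs_sub _ _).trans ?_
    rw [abs_mul, abs_mul, abs_mul, abs_two]
    set A := |s i ^ 2 * tiltP N μ i0 2 (β * s i) - q|
    set B := |s i ^ 1 * tiltP N μ i0 1 (β * s i) - r ^ 2|
    have hB : 0 ≤ B := abs_nonneg _
    have hYB : |Y i| * B ≤ B := mul_le_of_le_one_left hB hY
    push_cast at h1 h2
    have : (6 + 8 * β) * |s i - r| ≤ (6 + 8 * β) * (|t - r| + 1 / n) := by gcongr
    nlinarith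
  have h1 := avg_le hn F _ hF
  have h2 : |1 / (n : ℝ) * ∑ i, Y i - r ^ 2| ≤ 2 * |t - r| + 1 / n := by
    simp only [Y]
    rw [avg_Y hn σ, ← ht, show t ^ 2 - 1 / (n : ℝ) - r ^ 2 = (t + r) * (t - r) - 1 / n by ring]
    refine (abs_sub _ _).trans ?_
    rw [abs_mul, abs_of_pos (show 0 < 1 / (n : ℝ) by positivity)]
    have := abs_add_le t r
    have h3 : |t + r| * |t - r| ≤ 2 * |t - r| := by gcongr; linarith
    linarith
  have h3 : |2 * r ^ 2 * (1 / (n : ℝ) * ∑ i, Y i - r ^ 2)| ≤ 2 * (2 * |t - r| + 1 / n) := by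
    rw [abs_mul]
    have : |2 * r ^ 2| ≤ 2 := by
      rw [abs_mul, abs_two, abs_pow]
      have := pow_le_one₀ (n := 2) (abs_nonneg r) hr
      linarith
    exact mul_le_mul this h2 (abs_nonneg _) (by norm_num)
  refine (abs_sub _ _).trans ?_
  have h4 := abs_add_le (1 / (n : ℝ) * ∑ i, obsX N μ i0 β 2 i σ) (1 / (n : ℝ) * ∑ i, F i)
  have h5 : 0 < 1 / (n : ℝ) := by positivity
  nlinarith

lemma point_t (hn : 1 ≤ n) (i0 : Fin N) (β : ℝ) (hβ : 0 < β) (σ : Fin n → UnitSphere N) :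
    |(‖totalSpin σ‖ / n) ^ 2 - ‖totalSpin σ‖ / n * tiltP N μ i0 1 (β * (‖totalSpin σ‖ / n))| ≤
      |1 / (n : ℝ) * ∑ i, obsX N μ i0 β 1 i σ| + (2 + 2 * β) * (1 / n) := by
  have hn' : 0 < (n : ℝ) := by exact_mod_cast hn
  have ht1 : |‖totalSpin σ‖ / n| ≤ 1 := mag_norm hn σ
  have hY := avg_Y hn σ
  set t := ‖totalSpin σ‖ / n with ht
  let F : Fin n → ℝ := fun i => ‖locF σ i‖ ^ 1 * tiltP N μ i0 1 (β * ‖locF σ i‖) -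
    t ^ 1 * tiltP N μ i0 1 (β * t)
  have hF : ∀ i, |F i| ≤ (1 + 2 * β) * (1 / n) := fun i => by
    have h1 := tiltQ_lip (μ := μ) i0 β hβ 1 (s := ‖locF σ i‖)
      (by rw [abs_norm]; exact locF_norm_le σ i) ht1
    have h2 := locF_close σ i
    push_cast at h1
    refine h1.trans ?_
    gcongr
  have hT : t * tiltP N μ i0 1 (β * t) =
      1 / (n : ℝ) * ∑ _i : Fin n, t ^ 1 * tiltP N μ i0 1 (β * t) := by
    simp only [Finset.sum_const, Finset.card_univ, Fintype.card_fin, nsmul_eq_mul]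
    field_simp
  have e : t ^ 2 - t * tiltP N μ i0 1 (β * t) =
      1 / (n : ℝ) * ∑ i, obsX N μ i0 β 1 i σ + 1 / (n : ℝ) * ∑ i, F i + 1 / n := by
    rw [hT]
    simp only [F, obsX, Finset.sum_sub_distrib, pow_one] at hY ⊢
    linarith
  rw [e]
  have h1 := avg_le hn F _ hF
  have h2 := abs_add_le (1 / (n : ℝ) * ∑ i, obsX N μ i0 β 1 i σ + 1 / (n : ℝ) * ∑ i, F i) (1 / n)
  have h3 := abs_add_le (1 / (n : ℝ) * ∑ i, obsX N μ i0 β 1 i σ) (1 / (n : ℝ) * ∑ i, F i)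
  rw [abs_of_pos (show 0 < 1 / (n : ℝ) by positivity)] at h2
  linarith

end final

/-- With `λ = (1 - β f'(b))/n`, one has `E|(1/(2λ)) D₂ - B²| ≤ C n^{-1/2}`, where
`B² = (4β²/((1 - β f'(b)) b²)) (1 - (N-1) f(b)/b - f(b)²)`. -/
theorem conditional_variance_bound (N : ℕ) (hN : 2 ≤ N)
    (μ : Measure (UnitSphere N)) [IsProbabilityMeasure μ]
    (hμinv : ∀ e : EuclideanSpace ℝ (Fin N) ≃ₗᵢ[ℝ] EuclideanSpace ℝ (Fin N),
      Measure.map (sphereMap e) μ = μ)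
    (β : ℝ) (hβ : (N : ℝ) < β)
    (b : ℝ) (hb : 0 < b) (hbfix : b = β * besselRatio N b) :
    ∃ C > 0, ∀ n : ℕ, 1 ≤ n →
      (∫ σ, |1 / (2 * ((1 - β * deriv (besselRatio N) b) / n)) * D2 N n β b μ σ -
            4 * β ^ 2 / ((1 - β * deriv (besselRatio N) b) * b ^ 2) *
              (1 - ((N : ℝ) - 1) * besselRatio N b / b - besselRatio N b ^ 2)|
          ∂(gibbsMeasure N n β μ)) ≤ C / Real.sqrt n := by
  by_cases hκ : 1 - β * deriv (besselRatio N) b = 0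
  · refine ⟨1, one_pos, fun n hn => ?_⟩
    rw [hκ]
    simp
  have hN' : (2 : ℝ) ≤ N := by exact_mod_cast hN
  have hβ0 : 0 < β := by linarith
  let i0 : Fin N := ⟨0, by omega⟩
  obtain ⟨δ, hδ, h, hh, hsmall⟩ := small_prob hN hμinv i0 β hβ
  obtain ⟨c, hc, hphi⟩ := phi_lower hN hμinv i0 β hβ0 b hb hbfix hκ δ hδ
  set κ := 1 - β * deriv (besselRatio N) b with hκd
  have hbe : besselRatio N b = tiltP N μ i0 1 b := by rw [besselRatio_eq hN hμinv i0]
  set r := b / β with hr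
  have hrpos : 0 < r := by positivity
  have hbr : β * r = b := by rw [hr]; field_simp
  have hfr : besselRatio N b = r := by rw [hr, eq_div_iff hβ0.ne']; linarith
  have hP1 : tiltP N μ i0 1 b = r := by rw [← hbe, hfr]
  have hr1 : |r| ≤ 1 := by rw [← hP1]; exact tiltP_abs_le i0 1 b
  have hP2 : tiltP N μ i0 2 b = 1 - ((N : ℝ) - 1) * r / b := by
    have h1 := tiltM_parts hμinv i0 b
    have h2 := tiltM_zero_pos (μ := μ) i0 b
    rw [← hP1, tiltP, tiltP]
    field_simp
    linarith
  have hrr : r ^ 1 * tiltP N μ i0 1 (β * r) = r ^ 2 := by rw [hbr, hP1]; ring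
  set M := |2 * β ^ 4 / (κ * b ^ 4)| with hM
  have hM0 : 0 ≤ M := abs_nonneg _
  set K := 10 + 8 * β with hK
  have hK0 : 0 < K := by positivity
  refine ⟨M * ((21 + 8 * β) + K * (1 / c * ((13 + 8 * β) + (2 + 2 * β)) + 2 / h + 1)) + 1,
    by positivity, fun n hn => ?_⟩
  have hn' : 0 < (n : ℝ) := by exact_mod_cast hn
  have hn1 : 1 ≤ (n : ℝ) := by exact_mod_cast hn
  set G := gibbsMeasure N n β μ with hG
  set S := {σ : Fin n → UnitSphere N | ‖totalSpin σ‖ / n < δ} with hS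
  have hsn : 0 < √(n : ℝ) := sqrt_pos.2 hn'
  have hns : 1 / (n : ℝ) ≤ 1 / √n := by
    apply one_div_le_one_div_of_le hsn
    rw [sqrt_le_left hn'.le]; nlinarith
  have hpt : ∀ σ : Fin n → UnitSphere N,
      |1 / (2 * (κ / n)) * D2 N n β b μ σ - 4 * β ^ 2 / (κ * b ^ 2) *
        (1 - ((N : ℝ) - 1) * besselRatio N b / b - besselRatio N b ^ 2)| ≤
      M * (|1 / (n : ℝ) * ∑ i, obsX N μ i0 β 2 i σ| + K * (1 / c *
        (|1 / (n : ℝ) * ∑ i, obsX N μ i0 β 1 i σ| + (2 + 2 * β) * (1 / n)) +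
          2 * S.indicator (fun _ => (1 : ℝ)) σ + 1 / n)) := fun σ => by
    have e : 1 / (2 * (κ / n)) * D2 N n β b μ σ - 4 * β ^ 2 / (κ * b ^ 2) *
        (1 - ((N : ℝ) - 1) * besselRatio N b / b - besselRatio N b ^ 2) =
        2 * β ^ 4 / (κ * b ^ 4) * (1 / (n : ℝ) * ∑ i, locV N μ i0 β i σ -
          (2 * (r ^ 2 * tiltP N μ i0 2 (β * r)) - 2 * r ^ 4)) := by
      rw [D2_eq hμinv i0 β b hb, hbr, hP2, hfr]
      have : r ^ 2 * (β ^ 4 / b ^ 4) = β ^ 2 / b ^ 2 := by rw [hr]; field_simp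
      have e2 : 1 / (2 * (κ / n)) * (4 * β ^ 4 / (n * b ^ 4) *
          (1 / (n : ℝ) * ∑ i, locV N μ i0 β i σ)) =
          2 * β ^ 4 / (κ * b ^ 4) * (1 / (n : ℝ) * ∑ i, locV N μ i0 β i σ) := by
        field_simp
        ring
      rw [e2, mul_sub]
      have e3 : 4 * β ^ 2 / (κ * b ^ 2) = 4 / κ * (β ^ 2 / b ^ 2) := by field_simp
      rw [e3, ← this]
      field_simp
      ring
    rw [e, abs_mul]
    refine mul_le_mul_of_nonneg_left ?_ hM0
    refine (point_V hn i0 β hβ0 r hr1 hrr σ).trans ?_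
    have h1 := point_t (μ := μ) hn i0 β hβ0 σ
    have ht1 := mag_norm hn σ
    have hob := abs_nonneg (1 / (n : ℝ) * ∑ i, obsX N μ i0 β 1 i σ)
    have hkey : |‖totalSpin σ‖ / n - r| ≤ 1 / c *
        (|1 / (n : ℝ) * ∑ i, obsX N μ i0 β 1 i σ| + (2 + 2 * β) * (1 / n)) +
          2 * S.indicator (fun _ => (1 : ℝ)) σ := by
      by_cases hσ : σ ∈ S
      · rw [Set.indicator_of_mem hσ]
        have h2 := abs_sub (‖totalSpin σ‖ / n) r
        have h3 : 0 ≤ 1 / c *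
          (|1 / (n : ℝ) * ∑ i, obsX N μ i0 β 1 i σ| + (2 + 2 * β) * (1 / n)) := by positivity
        linarith
      · rw [Set.indicator_of_notMem hσ]
        have h2 : δ ≤ ‖totalSpin σ‖ / n := not_lt.1 hσ
        have h3 := (hphi _ ⟨h2, (le_abs_self _).trans ht1⟩).trans h1
        rw [mul_zero, add_zero, one_div, le_inv_mul_iff₀ hc]
        exact h3
    gcongr
  have hX1 : Continuous fun σ : Fin n → UnitSphere N =>
      |1 / (n : ℝ) * ∑ i, obsX N μ i0 β 1 i σ| :=
    (continuous_const.mul (continuous_finsetSum _ fun i _ => obsX_continuous i0 β 1 i)).abs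
  have hX2 : Continuous fun σ : Fin n → UnitSphere N =>
      |1 / (n : ℝ) * ∑ i, obsX N μ i0 β 2 i σ| :=
    (continuous_const.mul (continuous_finsetSum _ fun i _ => obsX_continuous i0 β 2 i)).abs
  have hI1 := aux_integrable G hX1
  have hI2 := aux_integrable G hX2
  have hSm : MeasurableSet S := by
    have := totalSpin_continuous (N := N) (n := n)
    exact (isOpen_lt (by fun_prop) continuous_const).measurableSet
  have hIS : Integrable (fun σ => S.indicator (fun _ => (1 : ℝ)) σ) G :=
    (integrable_const (1 : ℝ)).indicator hSm
  have hJ1 : Integrable (fun σ => 1 / c *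
        (|1 / (n : ℝ) * ∑ i, obsX N μ i0 β 1 i σ| + (2 + 2 * β) * (1 / n))) G :=
    (hI1.add (integrable_const _)).const_mul _
  have hJ2 : Integrable (fun σ => 1 / c *
        (|1 / (n : ℝ) * ∑ i, obsX N μ i0 β 1 i σ| + (2 + 2 * β) * (1 / n)) +
          2 * S.indicator (fun _ => (1 : ℝ)) σ) G := hJ1.add (hIS.const_mul _)
  have hJ3 : Integrable (fun σ => K * (1 / c *
        (|1 / (n : ℝ) * ∑ i, obsX N μ i0 β 1 i σ| + (2 + 2 * β) * (1 / n)) +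
          2 * S.indicator (fun _ => (1 : ℝ)) σ + 1 / n)) G :=
    (hJ2.add (integrable_const _)).const_mul _
  have hv1 := obs_var hN hμinv i0 β hβ0 1 hn
  have hv2 := obs_var hN hμinv i0 β hβ0 2 hn
  have hs := hsmall n hn
  rw [← hG] at hv1 hv2 hs
  rw [← hS] at hs
  refine (integral_mono_of_nonneg (Filter.Eventually.of_forall fun σ => abs_nonneg _)
    ((hI2.add hJ3).const_mul M) (Filter.Eventually.of_forall hpt)).trans ?_
  simp only [Pi.add_apply]
  rw [integral_const_mul, integral_add hI2 hJ3, integral_const_mul,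
    integral_add hJ2 (integrable_const _), integral_add hJ1 (hIS.const_mul _),
    integral_const_mul, integral_const_mul, integral_add hI1 (integrable_const _)]
  simp only [integral_const, probReal_univ, one_smul]
  push_cast at hv1 hv2
  set A1 := ∫ σ, |1 / (n : ℝ) * ∑ i, obsX N μ i0 β 1 i σ| ∂G
  set A2 := ∫ σ, |1 / (n : ℝ) * ∑ i, obsX N μ i0 β 2 i σ| ∂G
  set A3 := ∫ σ, S.indicator (fun _ => (1 : ℝ)) σ ∂G
  have hs' : A3 ≤ 1 / h * (1 / √n) := by
    refine hs.trans ?_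
    rw [show 1 / (h * (n : ℝ)) = 1 / h * (1 / n) by field_simp]
    gcongr
  have hv1' : A1 ≤ (13 + 8 * β) * (1 / √n) := hv1.trans (le_of_eq (by ring))
  have hv2' : A2 ≤ (21 + 8 * β) * (1 / √n) := hv2.trans (le_of_eq (by ring))
  calc M * (A2 + K * (1 / c * (A1 + (2 + 2 * β) * (1 / n)) + 2 * A3 + 1 / n))
      ≤ M * ((21 + 8 * β) * (1 / √n) + K * (1 / c * ((13 + 8 * β) * (1 / √n) +
        (2 + 2 * β) * (1 / √n)) + 2 * (1 / h * (1 / √n)) + 1 / √n)) := by gcongr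
    _ = M * ((21 + 8 * β) + K * (1 / c * ((13 + 8 * β) + (2 + 2 * β)) + 2 / h + 1)) / √n := by
      field_simp
    _ ≤ _ := by
      gcongr
      linarith

end
end

section
/- For every x > 0, the second derivative of the function x ↦ x f(x) satisfies |(x f(x))″| < 6. -/
open MeasureTheory Real

noncomputable section

/-- Abstract ODE argument. -/
theorem riccati_bound (k : ℕ) (f V : ℝ → ℝ) (hf : ∀ y, HasDerivAt f (V y) y)
    (hV : ∀ y, 0 ≤ V y) (h0 : f 0 = 0)
    (hR : ∀ y, y * V y = y * (1 - f y ^ 2) - ((k : ℝ) + 1) * f y) (x : ℝ) (hx : 0 < x) :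
    |deriv (deriv (fun y => y * f y)) x| < 6 := by
  have hmono : Monotone f := monotone_of_deriv_nonneg (fun y => (hf y).differentiableAt)
    (fun y => by rw [(hf y).deriv]; exact hV y)
  have hpos : ∀ y, 0 ≤ y → 0 ≤ f y := fun y hy => h0 ▸ hmono hy
  have hg : deriv (fun y => y * f y) = fun y => y * (1 - f y ^ 2) - (k : ℝ) * f y := by
    funext y
    have := ((hasDerivAt_id y).mul (hf y)).deriv
    have e : (fun y => y * f y) = id * f := by funext z; simp
    rw [e, this]
    have := hR y
    simp only [id]
    linarith
  have hg2 : HasDerivAt (fun y => y * (1 - f y ^ 2) - (k : ℝ) * f y)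
      ((1 - f x ^ 2) - 2 * x * f x * V x - k * V x) x := by
    have h1 := ((hasDerivAt_id' x).fun_mul (((hf x).fun_pow 2).const_sub 1)).fun_sub
      ((hf x).const_mul (k : ℝ))
    refine h1.congr_deriv ?_
    push_cast
    ring
  rw [hg, hg2.deriv]
  have hψ : ∀ y, HasDerivAt (fun y => y ^ (k + 1) * (y * f y ^ 2 + ((k : ℝ) + 2) * f y - y))
      (y ^ k * (2 * y ^ 2 * f y * V y)) y := by
    intro y
    have h1 := (hasDerivAt_pow (k + 1) y).fun_mul
      ((((hasDerivAt_id' y).fun_mul ((hf y).fun_pow 2)).fun_add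
        ((hf y).const_mul ((k : ℝ) + 2))).fun_sub (hasDerivAt_id' y))
    refine h1.congr_deriv ?_
    have := hR y
    simp only [Nat.add_sub_cancel]
    push_cast
    linear_combination y ^ k * ((k : ℝ) + 2) * this
  have hm : MonotoneOn (fun y => y ^ (k + 1) * (y * f y ^ 2 + ((k : ℝ) + 2) * f y - y))
      (Set.Ici 0) := by
    apply monotoneOn_of_deriv_nonneg (convex_Ici 0)
    · exact fun y _ => (hψ y).continuousAt.continuousWithinAt
    · exact fun y _ => (hψ y).differentiableAt.differentiableWithinAt
    · intro y hy
      rw [interior_Ici] at hy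
      have hy' : 0 < y := hy
      rw [(hψ y).deriv]
      have := hpos y hy'.le
      have := hV y
      positivity
  have hφ : 0 ≤ x * f x ^ 2 + ((k : ℝ) + 2) * f x - x := by
    have := hm (Set.mem_Ici.2 le_rfl) (Set.mem_Ici.2 hx.le) hx.le
    simp only [h0] at this
    have h2 : 0 ≤ x ^ (k + 1) * (x * f x ^ 2 + ((k : ℝ) + 2) * f x - x) := by
      simpa using this
    exact nonneg_of_mul_nonneg_right h2 (by positivity)
  have hfx := hpos x hx.le
  have hVx := hV x
  have hRx := hR x
  have hk : (0 : ℝ) ≤ k := Nat.cast_nonneg k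
  -- x V ≤ f
  have h1 : x * V x ≤ f x := by linarith
  have hf1 : f x ^ 2 ≤ 1 := by
    have : 0 ≤ x * (1 - f x ^ 2) := by
      have := mul_nonneg hx.le hVx
      have := mul_nonneg (by linarith : (0:ℝ) ≤ (k : ℝ) + 1) hfx
      linarith
    have := nonneg_of_mul_nonneg_right this hx
    linarith
  have h2 : x * V x * f x ≤ 1 := by nlinarith
  have h3 : k * V x ≤ 1 - f x ^ 2 := by
    have : 0 ≤ x * (1 - f x ^ 2 - k * V x) := by
      have := mul_le_mul_of_nonneg_left h1 hk
      have := mul_nonneg hx.le hVx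
      nlinarith
    have := nonneg_of_mul_nonneg_right this hx
    linarith
  have h4 : 0 ≤ x * V x * f x := by positivity
  have h5 : 0 ≤ k * V x := by positivity
  have h6 := sq_nonneg (f x)
  rw [abs_lt]
  constructor <;> nlinarith

/-- Moments. -/
def bZ (n k : ℕ) (x : ℝ) : ℝ := ∫ θ in (0:ℝ)..π, exp (x * cos θ) * cos θ ^ k * sin θ ^ n

theorem bZ_int (n k : ℕ) (x : ℝ) :
    IntervalIntegrable (fun θ => exp (x * cos θ) * cos θ ^ k * sin θ ^ n) volume 0 π :=
  Continuous.intervalIntegrable (by fun_prop) _ _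

theorem bZ_deriv (n k : ℕ) (x : ℝ) : HasDerivAt (bZ n k) (bZ n (k + 1) x) x := by
  refine (intervalIntegral.hasDerivAt_integral_of_dominated_loc_of_deriv_le
    (F := fun x θ => exp (x * cos θ) * cos θ ^ k * sin θ ^ n)
    (F' := fun x θ => exp (x * cos θ) * cos θ ^ (k + 1) * sin θ ^ n)
    (bound := fun _ => exp (|x| + 1)) (Metric.ball_mem_nhds x one_pos) ?_ (bZ_int n k x)
    ?_ ?_ ?_ ?_).2
  · exact Filter.Eventually.of_forall fun y => (by fun_prop : Continuous _).aestronglyMeasurable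
  · exact (by fun_prop : Continuous _).aestronglyMeasurable
  · refine Filter.Eventually.of_forall fun θ _ y hy => ?_
    rw [Metric.mem_ball, Real.dist_eq] at hy
    rw [norm_mul, norm_mul, norm_pow, norm_pow, Real.norm_eq_abs, Real.norm_eq_abs,
      Real.norm_eq_abs, abs_of_pos (exp_pos _)]
    have h1 : |cos θ| ^ (k + 1) ≤ 1 := pow_le_one₀ (abs_nonneg _) (abs_cos_le_one θ)
    have h2 : |sin θ| ^ n ≤ 1 := pow_le_one₀ (abs_nonneg _) (abs_sin_le_one θ)
    have h3 : exp (y * cos θ) ≤ exp (|x| + 1) := by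
      apply exp_le_exp.2
      have : |y| ≤ |x| + 1 := by
        have := abs_sub_abs_le_abs_sub y x
        linarith
      calc y * cos θ ≤ |y * cos θ| := le_abs_self _
        _ = |y| * |cos θ| := abs_mul _ _
        _ ≤ |y| * 1 := by gcongr; exact abs_cos_le_one θ
        _ ≤ _ := by linarith
    calc _ ≤ exp (|x| + 1) * 1 * 1 := by gcongr
      _ = _ := by ring
  · exact intervalIntegrable_const
  · refine Filter.Eventually.of_forall fun θ _ y _ => ?_
    have := ((((hasDerivAt_id' y).mul_const (cos θ)).exp).mul_const (cos θ ^ k)).mul_const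
      (sin θ ^ n)
    refine this.congr_deriv ?_
    ring

theorem bZ_pos (n : ℕ) (x : ℝ) : 0 < bZ n 0 x := by
  apply intervalIntegral.intervalIntegral_pos_of_pos_on (bZ_int n 0 x) _ pi_pos
  intro θ hθ
  have := sin_pos_of_pos_of_lt_pi hθ.1 hθ.2
  positivity

theorem bZ_sin (n : ℕ) (x : ℝ) :
    ∫ θ in (0:ℝ)..π, exp (x * cos θ) * sin θ ^ (n + 2) = bZ n 0 x - bZ n 2 x := by
  unfold bZ
  rw [← intervalIntegral.integral_sub (bZ_int n 0 x) (bZ_int n 2 x)]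
  congr 1
  funext θ
  have := sin_sq_add_cos_sq θ
  linear_combination exp (x * cos θ) * sin θ ^ n * this

theorem bZ_parts (n : ℕ) (x : ℝ) :
    x * (bZ n 0 x - bZ n 2 x) = ((n : ℝ) + 1) * bZ n 1 x := by
  rw [← bZ_sin]
  have h := intervalIntegral.integral_eq_sub_of_hasDerivAt (a := 0) (b := π)
    (f := fun θ => exp (x * cos θ) * sin θ ^ (n + 1))
    (f' := fun θ => ((n : ℝ) + 1) * (exp (x * cos θ) * cos θ ^ 1 * sin θ ^ n)
      - x * (exp (x * cos θ) * sin θ ^ (n + 2))) (fun θ _ => by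
      have := (((hasDerivAt_cos θ).const_mul x).exp).fun_mul ((hasDerivAt_sin θ).fun_pow (n + 1))
      refine this.congr_deriv ?_
      simp only [Nat.add_sub_cancel]
      push_cast
      ring) (Continuous.intervalIntegrable (by fun_prop) _ _)
  rw [intervalIntegral.integral_sub (Continuous.intervalIntegrable (by fun_prop) _ _)
    (Continuous.intervalIntegrable (by fun_prop) _ _),
    intervalIntegral.integral_const_mul, intervalIntegral.integral_const_mul] at h
  simp only [sin_pi, sin_zero, zero_pow (Nat.succ_ne_zero n), mul_zero, sub_zero] at h
  unfold bZ
  linarith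

theorem bZ_var (n : ℕ) (x c : ℝ) : 0 ≤ bZ n 2 x - 2 * c * bZ n 1 x + c ^ 2 * bZ n 0 x := by
  have h : bZ n 2 x - 2 * c * bZ n 1 x + c ^ 2 * bZ n 0 x =
      ∫ θ in (0:ℝ)..π, exp (x * cos θ) * (cos θ - c) ^ 2 * sin θ ^ n := by
    unfold bZ
    rw [← intervalIntegral.integral_const_mul, ← intervalIntegral.integral_const_mul,
      ← intervalIntegral.integral_sub (bZ_int n 2 x) ((bZ_int n 1 x).const_mul _),
      ← intervalIntegral.integral_add ((bZ_int n 2 x).sub ((bZ_int n 1 x).const_mul _))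
        ((bZ_int n 0 x).const_mul _)]
    congr 1
    funext θ
    ring
  rw [h]
  apply intervalIntegral.integral_nonneg pi_pos.le
  intro θ hθ
  have := sin_nonneg_of_nonneg_of_le_pi hθ.1 hθ.2
  positivity

/-- For every `x > 0`, the second derivative of `x ↦ x f(x)` satisfies `|(x f(x))''| < 6`. -/
theorem besselRatio_xf_second_deriv_bound (N : ℕ) (hN : 2 ≤ N) (x : ℝ) (hx : 0 < x) :
    |deriv (deriv (fun y => y * besselRatio N y)) x| < 6 := by
  obtain ⟨n, rfl⟩ : ∃ n, N = n + 2 := ⟨N - 2, by omega⟩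
  have hb : besselRatio (n + 2) = fun y => bZ n 1 y / bZ n 0 y := by
    funext y
    unfold besselRatio
    rw [bZ_sin, Nat.add_sub_cancel]
    have h0 : ∫ θ in (0:ℝ)..π, exp (y * cos θ) * sin θ ^ n = bZ n 0 y := by
      simp [bZ]
    rw [h0]
    have hp := bZ_parts n y
    have hn : (n : ℝ) + 1 ≠ 0 := by positivity
    have e : ((n + 2 : ℕ) : ℝ) - 1 = n + 1 := by push_cast; ring
    rw [e]
    congr 1
    rw [div_mul_eq_mul_div, hp]
    field_simp
  rw [hb]
  apply riccati_bound n (fun y => bZ n 1 y / bZ n 0 y)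
    (fun y => bZ n 2 y / bZ n 0 y - (bZ n 1 y / bZ n 0 y) ^ 2) _ _ _ _ x hx
  · intro y
    have hz := (bZ_pos n y).ne'
    refine ((bZ_deriv n 1 y).fun_div (bZ_deriv n 0 y) hz).congr_deriv ?_
    field_simp
  · intro y
    have hz := bZ_pos n y
    have h := bZ_var n y (bZ n 1 y / bZ n 0 y)
    have e : bZ n 2 y / bZ n 0 y - (bZ n 1 y / bZ n 0 y) ^ 2 =
      (bZ n 2 y - 2 * (bZ n 1 y / bZ n 0 y) * bZ n 1 y + (bZ n 1 y / bZ n 0 y) ^ 2 * bZ n 0 y)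
        / bZ n 0 y := by
      field_simp
      ring
    rw [e]
    positivity
  · have hp := bZ_parts n 0
    rw [zero_mul] at hp
    have hn : (n : ℝ) + 1 ≠ 0 := by positivity
    have : bZ n 1 0 = 0 := by
      rcases mul_eq_zero.1 hp.symm with h | h
      · exact absurd h hn
      · exact h
    simp [this]
  · intro y
    have hz := bZ_pos n y
    have hp := bZ_parts n y
    field_simp
    linear_combination -bZ n 0 y * hp

end
end
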